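/- arXiv:0810.0821 — 3 statements merged into one kernel-verified Lean document; each statement's English description precedes it below -/
import Mathlib

section
/- Let 𝓑 be a bounded subset of GL_r(k((z))). Then there exists a natural number c such that for every natural number d, every g ∈ 𝓑 and every h ∈ I_{d+c}, there exists x ∈ I_d with g·h = x⁻¹·g·σ(x). -/
noncomputable section

open scoped Classical

namespace HVpaper

variable {A : Type*} [CommRing A]

/-- Coefficientwise `q`-th power map on formal Laurent series (the map `σ` for `q ≠ 0`;
junk value `0` for `q = 0`). -/
def laurentFrob (q : ℕ) (x : LaurentSeries A) : LaurentSeries A :=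
  if hq : q = 0 then 0 else x.map (ZeroHom.mk (fun a : A => a ^ q) (zero_pow hq))

/-- Entrywise `σ` on matrices of Laurent series. -/
def matFrob (q : ℕ) {n : Type*} (M : Matrix n n (LaurentSeries A)) :
    Matrix n n (LaurentSeries A) :=
  M.map (laurentFrob q)

/-- `x` lies in `z^n · A⟦z⟧`, i.e. all coefficients below `n` vanish. -/
def InZPow (n : ℤ) (x : LaurentSeries A) : Prop :=
  ∀ m : ℤ, m < n → x.coeff m = 0

/-- `x` lies in the subring `A⟦z⟧` of `A((z))`. -/
def InPS (x : LaurentSeries A) : Prop :=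
  ∀ m : ℤ, m < 0 → x.coeff m = 0

variable {k : Type*} [Field k]

/-- Membership in the subgroup `I_n` of `GL_r(k⟦z⟧)`:  `g` and its inverse have entries in
`k⟦z⟧`, the diagonal entries satisfy `g_{ii} − 1 ∈ zⁿk⟦z⟧`, the entries above the diagonal lie
in `zⁿk⟦z⟧` and those below the diagonal lie in `z^(n+1)k⟦z⟧`.  For `n = 0` this is the
standard Iwahori subgroup. -/
def InIwahori {r : ℕ} (n : ℕ) (g : Matrix (Fin r) (Fin r) (LaurentSeries k)) : Prop :=
  (∀ i j, InPS (g i j)) ∧ IsUnit g ∧ (∀ i j, InPS (g⁻¹ i j)) ∧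
  (∀ i : Fin r, InZPow (n : ℤ) (g i i - 1)) ∧
  (∀ i j : Fin r, i < j → InZPow (n : ℤ) (g i j)) ∧
  (∀ i j : Fin r, j < i → InZPow ((n : ℤ) + 1) (g i j))

section Abstract
open Module

variable {k : Type*} [Field k] {V : Type*} [AddCommGroup V] [Module k V]

theorem aux_relcompl (U2 U : Submodule k V) (h : U2 ≤ U) :
    ∃ X : Submodule k V, X ⊓ U2 = ⊥ ∧ X ⊔ U2 = U := by
  obtain ⟨C, hC⟩ := exists_isCompl U2
  refine ⟨C ⊓ U, ?_, ?_⟩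
  · have := hC.inf_eq_bot
    rw [eq_bot_iff, ← this]
    exact le_inf inf_le_right (inf_le_left.trans inf_le_left)
  · rw [sup_comm, sup_inf_assoc_of_le _ h |>.symm, hC.sup_eq_top, top_inf_eq]

theorem aux_dimB [FiniteDimensional k V] (a : V →ₗ[k] V) (U2 U : Submodule k V) (h : U2 ≤ U) :
    finrank k (U.map a) + finrank k U2 ≤ finrank k (U2.map a) + finrank k U := by
  obtain ⟨X, h1, h2⟩ := aux_relcompl U2 U h
  have e1 := Submodule.finrank_sup_add_finrank_inf_eq X U2
  rw [h1, h2, finrank_bot] at e1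
  have e2 := Submodule.finrank_add_le_finrank_add_finrank (X.map a) (U2.map a)
  rw [← Submodule.map_sup, h2] at e2
  have e3 := Submodule.finrank_map_le a X
  omega

theorem aux_semifinrank [FiniteDimensional k V] (σ : k →+* k) [RingHomSurjective σ]
    (b : V →ₛₗ[σ] V) (X : Submodule k V) (hX : ∀ x ∈ X, b x = 0 → x = 0) :
    finrank k X ≤ finrank k (X.map b) := by
  let v := Module.finBasis k X
  have hli : LinearIndependent k (fun i => (⟨b (v i), Submodule.mem_map_of_mem (v i).2⟩ : X.map b)) := by
    have := v.linearIndependent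
    let j : X →+ X.map b :=
      { toFun := fun x => ⟨b x, Submodule.mem_map_of_mem x.2⟩
        map_zero' := by ext; simp
        map_add' := by intro x y; ext; simp }
    refine this.map_of_surjective_injective σ j σ.surjective ?_ ?_
    · intro x hx
      have : b x = 0 := congrArg Subtype.val hx
      exact Subtype.ext (hX _ x.2 this)
    · intro r m
      ext
      simp [j]
  simpa using hli.fintype_card_le_finrank

theorem aux_dimA [FiniteDimensional k V] (σ : k →+* k) [RingHomSurjective σ]
    (b : V →ₛₗ[σ] V) (U W2 : Submodule k V) :
    finrank k U + finrank k W2 ≤ finrank k (U ⊓ W2.comap b : Submodule k V)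
      + finrank k (U.map b ⊔ W2 : Submodule k V) := by
  obtain ⟨X, h1, h2⟩ := aux_relcompl (U ⊓ W2.comap b) U inf_le_left
  have hXU : X ≤ U := h2 ▸ le_sup_left
  have e1 := Submodule.finrank_sup_add_finrank_inf_eq X (U ⊓ W2.comap b)
  rw [h1, h2, finrank_bot] at e1
  have key : ∀ x ∈ X, b x ∈ W2 → x = 0 := by
    intro x hx hb
    have : x ∈ X ⊓ (U ⊓ W2.comap b) := ⟨hx, hXU hx, hb⟩
    rw [h1] at this
    simpa using this
  have e2 := aux_semifinrank σ b X (fun x hx h0 => key x hx (h0 ▸ W2.zero_mem))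
  have e3 := Submodule.finrank_sup_add_finrank_inf_eq (X.map b) W2
  have h3 : X.map b ⊓ W2 = ⊥ := by
    rw [eq_bot_iff]
    rintro _ ⟨⟨x, hx, rfl⟩, hw⟩
    rw [key x hx hw]; simp
  rw [h3, finrank_bot] at e3
  have e4 : finrank k (X.map b ⊔ W2 : Submodule k V) ≤ finrank k (U.map b ⊔ W2 : Submodule k V) :=
    Submodule.finrank_mono (sup_le_sup_right (Submodule.map_mono hXU) _)
  omega

/-- Lang's theorem, additive version. -/
theorem aux_lang [FiniteDimensional k V] [IsAlgClosed k] (σ : k →+* k) (q : ℕ)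
    (hq : (q : k) = 0) (hσ : ∀ x, σ x = x ^ q)
    (φ : V →ₛₗ[σ] V) (w : V) : ∃ y, φ y - y = w := by
  let v : ℕ → V := fun n => (φ^[n]) w
  let S : ℕ →o Submodule k V :=
    ⟨fun n => Submodule.span k (v '' Set.Iio n), fun m n h =>
      Submodule.span_mono (Set.image_mono (Set.Iio_subset_Iio h))⟩
  obtain ⟨s, hs⟩ := monotone_stabilizes_iff_noetherian.mpr (inferInstance : IsNoetherian k V) S
  have hmem : v s ∈ Submodule.span k (v '' Set.Iio s) := by
    have : v s ∈ S (s + 1) := Submodule.subset_span ⟨s, by simp, rfl⟩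
    rw [← hs (s + 1) (by omega)] at this
    exact this
  have hrel : ∃ a : ℕ → k, v s = ∑ i ∈ Finset.range s, a i • v i := by
    have h2 : v '' Set.Iio s = v '' (Finset.range s : Set ℕ) := by simp
    rw [h2, Submodule.mem_span_image_finset_iff_exists_fun] at hmem
    obtain ⟨c, hc⟩ := hmem
    refine ⟨fun i => if h : i ∈ Finset.range s then c ⟨i, h⟩ else 0, ?_⟩
    rw [← hc, ← Finset.sum_coe_sort (Finset.range s)]
    refine Finset.sum_congr rfl fun i _ => ?_
    simp only [dif_pos i.2]
  obtain ⟨a, ha⟩ := hrel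
  have hv : ∀ n, φ (v n) = v (n + 1) := fun n => (Function.iterate_succ_apply' φ n w).symm
  rcases s with _ | s
  · refine ⟨0, ?_⟩
    have : w = 0 := by simpa [v] using ha
    simp [this]
  let c : ℕ → Polynomial k := fun n => Nat.rec (Polynomial.C (a 0) * Polynomial.X ^ q - 1)
    (fun i ci => ci ^ q + Polynomial.C (a (i + 1)) * Polynomial.X ^ q) n
  have hc0 : c 0 = Polynomial.C (a 0) * Polynomial.X ^ q - 1 := rfl
  have hcs : ∀ i, c (i+1) = c i ^ q + Polynomial.C (a (i + 1)) * Polynomial.X ^ q := fun i => rfl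
  have hder : ∀ i, Polynomial.derivative (c i) = 0 := by
    intro i
    cases i with
    | zero => simp [hc0, Polynomial.derivative_X_pow, hq]
    | succ i => simp [hcs, Polynomial.derivative_pow, hq]
  have hdeg : (c s - Polynomial.X).degree ≠ 0 := by
    intro h
    have h1 := Polynomial.eq_C_of_degree_eq_zero h
    have h2 : Polynomial.derivative (c s - Polynomial.X) = 0 := by
      rw [h1]; simp
    simp [hder] at h2
  obtain ⟨t, ht⟩ := IsAlgClosed.exists_root _ hdeg
  have ht : (c s).eval t = t := by
    simpa [Polynomial.IsRoot, sub_eq_zero] using ht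
  let e : ℕ → k := fun i => (c i).eval t
  have he0 : e 0 = a 0 * t ^ q - 1 := by simp [e, hc0]
  have hes : ∀ i, e (i + 1) = e i ^ q + a (i + 1) * t ^ q := by intro i; simp [e, hcs]
  have het : e s = t := ht
  refine ⟨∑ i ∈ Finset.range (s+1), e i • v i, ?_⟩
  have h1 : φ (∑ i ∈ Finset.range (s+1), e i • v i)
      = ∑ i ∈ Finset.range s, (e i ^ q) • v (i+1) + t ^ q • v (s+1) := by
    rw [map_sum, Finset.sum_range_succ]
    simp [hv, hσ, het]
  rw [h1, ha, Finset.sum_range_succ' (fun i => e i • v i), he0,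
    Finset.sum_range_succ' (fun i => a i • v i)]
  simp only [hes, add_smul, smul_add, Finset.sum_add_distrib, Finset.smul_sum, smul_smul, sub_smul,
    mul_comm (t ^ q)]
  have : v 0 = w := rfl
  rw [this, one_smul]
  abel

theorem aux_pencil [FiniteDimensional k V] [IsAlgClosed k] (σ : k →+* k) [RingHomSurjective σ]
    (q : ℕ) (hq : (q : k) = 0) (hσ : ∀ x, σ x = x ^ q)
    (a : V →ₗ[k] V) (b : V →ₛₗ[σ] V) (Z : V →ₗ[k] V)
    (haZ : ∀ v, a (Z v) = Z (a v)) (hbZ : ∀ v, b (Z v) = Z (b v)) (hZ : IsNilpotent Z)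
    (n : ℕ) : ∀ (δ : ℕ) (U W : Submodule k V), finrank k W ≤ n →
      finrank k W ≤ δ + finrank k (U.map a) →
      U.map a ≤ W → U.map b ≤ W → U.map Z ≤ U → W.map Z ≤ W →
      ∀ w ∈ W, ∃ u ∈ U, b u - a u = (Z ^ δ) w := by
  have haZn : ∀ n v, a ((Z ^ n) v) = (Z ^ n) (a v) := by
    intro n v
    induction n with
    | zero => simp
    | succ n ih => simp [pow_succ', haZ, ih]
  have hbZn : ∀ n v, b ((Z ^ n) v) = (Z ^ n) (b v) := by
    intro n v
    induction n with
    | zero => simp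
    | succ n ih => simp [pow_succ', hbZ, ih]
  have hst : ∀ (W : Submodule k V), W.map Z ≤ W → ∀ n, ∀ w ∈ W, (Z ^ n) w ∈ W := by
    intro W hW n w hw
    induction n with
    | zero => simpa
    | succ n ih =>
      rw [pow_succ']
      exact hW ⟨_, ih, rfl⟩
  induction n with
  | zero =>
    intro δ U W h0 _ _ _ _ _ w hw
    have : W = ⊥ := Submodule.finrank_eq_zero.mp (by omega)
    subst this
    refine ⟨0, U.zero_mem, ?_⟩
    have : w = 0 := by simpa using hw
    simp [this]
  | succ n ih =>
    intro δ U W hn hδ haU hbU hZU hZW w hw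
    by_cases hW2 : W.map Z ⊔ U.map a = W
    · -- Nakayama
      have hstep : ∀ i, ∀ w ∈ W, ∃ u ∈ U, ∃ w' ∈ W, w = a u + (Z ^ i) w' := by
        intro i
        induction i with
        | zero => intro w hw; exact ⟨0, U.zero_mem, w, hw, by simp⟩
        | succ i ih2 =>
          intro w hw
          obtain ⟨u, hu, w', hw', rfl⟩ := ih2 w hw
          rw [← hW2] at hw'
          obtain ⟨_, ⟨w'', hw'', rfl⟩, _, ⟨u', hu', rfl⟩, rfl⟩ := Submodule.mem_sup.mp hw'
          refine ⟨u + (Z ^ i) u', U.add_mem hu (hst U hZU i u' hu'), w'', hw'', ?_⟩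
          rw [map_add, map_add, haZn, pow_succ]
          simp only [Module.End.mul_apply]
          abel
      obtain ⟨m, hm⟩ := hZ
      have hsurj : ∀ w ∈ W, ∃ u ∈ U, w = a u := by
        intro w hw
        obtain ⟨u, hu, w', _, h⟩ := hstep m w hw
        exact ⟨u, hu, by simpa [hm] using h⟩
      let aU : U →ₗ[k] W := (a.domRestrict U).codRestrict W (fun u => haU ⟨u, u.2, rfl⟩)
      have haUs : Function.Surjective aU := by
        rintro ⟨w, hw⟩
        obtain ⟨u, hu, h⟩ := hsurj w hw
        exact ⟨⟨u, hu⟩, Subtype.ext h.symm⟩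
      obtain ⟨s, hs⟩ := aU.exists_rightInverse_of_surjective (LinearMap.range_eq_top.mpr haUs)
      let φ : W →ₛₗ[σ] W :=
        { toFun := fun x => ⟨b (s x), hbU ⟨s x, (s x).2, rfl⟩⟩
          map_add' := by intro x y; ext; simp
          map_smul' := by intro c x; ext; simp }
      obtain ⟨y, hy⟩ := aux_lang σ q hq hσ φ ⟨(Z ^ δ) w, hst W hZW δ w hw⟩
      refine ⟨s y, (s y).2, ?_⟩
      have h1 : a (s y) = y := congrArg Subtype.val (LinearMap.congr_fun hs y)
      rw [h1]
      exact congrArg Subtype.val hy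
    · set W2 := W.map Z ⊔ U.map a with hW2def
      have hW2W : W2 ≤ W := sup_le hZW haU
      have hlt : finrank k W2 < finrank k W :=
        Submodule.finrank_lt_finrank_of_lt (lt_of_le_of_ne hW2W hW2)
      set U2 := U ⊓ W2.comap b with hU2
      have hU2U : U2 ≤ U := inf_le_left
      have eA := aux_dimA σ b U W2
      rw [← hU2] at eA
      have eB := aux_dimB a U2 U hU2U
      have haU2 : U2.map a ≤ W2 := (Submodule.map_mono hU2U).trans le_sup_right
      have hbU2 : U2.map b ≤ W2 := by
        rintro _ ⟨u, hu, rfl⟩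
        exact hu.2
      have hZW2 : W2.map Z ≤ W2 := (Submodule.map_mono hW2W).trans le_sup_left
      have hZU2 : U2.map Z ≤ U2 := by
        rintro _ ⟨u, hu, rfl⟩
        refine ⟨hZU ⟨u, hu.1, rfl⟩, ?_⟩
        change b (Z u) ∈ W2
        rw [hbZ]
        exact hZW2 ⟨_, hu.2, rfl⟩
      have hle : U.map b ⊔ W2 ≤ W := sup_le hbU hW2W
      have hm := Submodule.finrank_mono haU2
      by_cases heq : U.map b ⊔ W2 = W
      · rw [heq] at eA
        rw [← heq] at hw
        obtain ⟨_, ⟨u, hu, rfl⟩, w2, hw2, rfl⟩ := Submodule.mem_sup.mp hw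
        obtain ⟨u', hu', h'⟩ := ih δ U2 W2 (by omega) (by omega) haU2 hbU2 hZU2 hZW2 (w2 + a u)
          (W2.add_mem hw2 (le_sup_right (a := W.map Z) ⟨u, hu, rfl⟩))
        refine ⟨u' + (Z ^ δ) u, U.add_mem (hU2U hu') (hst U hZU δ u hu), ?_⟩
        rw [map_add, map_add, haZn, hbZn, add_sub_add_comm, h', map_add, map_add]
        abel
      · have hlt2 := Submodule.finrank_lt_finrank_of_lt (lt_of_le_of_ne hle heq)
        obtain ⟨δ, rfl⟩ : ∃ δ', δ = δ' + 1 := ⟨δ - 1, by omega⟩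
        obtain ⟨u', hu', h'⟩ := ih δ U2 W2 (by omega) (by omega) haU2 hbU2 hZU2 hZW2 (Z w)
          (le_sup_left (b := U.map a) ⟨w, hw, rfl⟩)
        exact ⟨u', hU2U hu', by rw [h', pow_succ]; rfl⟩


theorem aux_core {R : Type*} [CommRing R] [Algebra k R] [IsAlgClosed k] (σ : k →+* k)
    [RingHomSurjective σ]
    (q : ℕ) (hq : (q : k) = 0) (hσ : ∀ x, σ x = x ^ q) (x : R) (hx : IsNilpotent x)
    (hR : ∀ f : R, ∃ (c : k) (u : R), f = algebraMap k R c + x * u)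
    (τ : R →+* R) (hτ : ∀ (c : k) (f : R), τ (c • f) = σ c • τ f) (hτx : τ x = x)
    {r : ℕ} (M : ℕ) (P P' Q Q' : Matrix (Fin r) (Fin r) R)
    (hP : P * P' = x ^ M • (1 : Matrix (Fin r) (Fin r) R))
    (hQ : Q' * Q = x ^ M • (1 : Matrix (Fin r) (Fin r) R))
    (w : Matrix (Fin r) (Fin r) R) :
    ∃ y : Matrix (Fin r) (Fin r) R,
      x ^ M • y.map τ - P * y * Q = x ^ (r * (r * (M + M))) • w := by
  have hR' : ∀ (m : ℕ) (f : R), ∃ (c : Fin m → k) (u : R), f = ∑ j, c j • x ^ (j : ℕ) + x ^ m * u := by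
    intro m
    induction m with
    | zero => intro f; exact ⟨fun _ => 0, f, by simp⟩
    | succ m ih =>
      intro f
      obtain ⟨c, u, hf⟩ := ih f
      obtain ⟨c', u', hu⟩ := hR u
      refine ⟨Fin.snoc c c', u', ?_⟩
      rw [Fin.sum_univ_castSucc]
      simp only [Fin.snoc_castSucc, Fin.snoc_last, Fin.val_castSucc, Fin.val_last]
      rw [hf, hu, Algebra.smul_def c']
      ring
  let ψ : (m : ℕ) → (Fin r × Fin r × Fin m → k) →ₗ[k] Matrix (Fin r) (Fin r) R := fun m =>
    { toFun := fun c => Matrix.of fun i l => ∑ j, c (i, l, j) • x ^ (j : ℕ)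
      map_add' := by
        intro c c'; ext i l; simp [add_smul, Finset.sum_add_distrib]
      map_smul' := by
        intro c c'; ext i l; simp [mul_smul, Finset.smul_sum] }
  have hψ : ∀ (m : ℕ) (v : Matrix (Fin r) (Fin r) R), ∃ c u, v = ψ m c + x ^ m • u := by
    intro m v
    choose c u h using fun i l => hR' m (v i l)
    refine ⟨fun t => c t.1 t.2.1 t.2.2, Matrix.of u, ?_⟩
    ext i l
    simpa [ψ] using h i l
  obtain ⟨n, hn⟩ := hx
  have hfin : FiniteDimensional k (Matrix (Fin r) (Fin r) R) := by
    refine Module.Finite.of_surjective (ψ n) ?_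
    intro v
    obtain ⟨c, u, h⟩ := hψ n v
    exact ⟨c, by rw [h, hn]; simp⟩
  let a : Matrix (Fin r) (Fin r) R →ₗ[k] Matrix (Fin r) (Fin r) R :=
    { toFun := fun y => P * y * Q
      map_add' := by intro y y'; rw [mul_add, add_mul]
      map_smul' := by intro c y; simp }
  let Z : Matrix (Fin r) (Fin r) R →ₗ[k] Matrix (Fin r) (Fin r) R :=
    { toFun := fun y => x • y
      map_add' := by intro y y'; rw [smul_add]
      map_smul' := by intro c y; exact smul_comm x c y }
  let b : Matrix (Fin r) (Fin r) R →ₛₗ[σ] Matrix (Fin r) (Fin r) R :=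
    { toFun := fun y => x ^ M • y.map τ
      map_add' := by intro y y'; ext; simp [mul_add]
      map_smul' := by intro c y; ext; simp [hτ] }
  have hZn : ∀ i v, (Z ^ i) v = x ^ i • v := by
    intro i v
    induction i with
    | zero => simp
    | succ i ih => rw [pow_succ', Module.End.mul_apply, ih, pow_succ', mul_smul]; rfl
  have hcod : finrank k (⊤ : Submodule k (Matrix (Fin r) (Fin r) R)) ≤
      r * (r * (M + M)) + finrank k ((⊤ : Submodule k (Matrix (Fin r) (Fin r) R)).map a) := by
    have htop : (⊤ : Submodule k (Matrix (Fin r) (Fin r) R)) =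
        LinearMap.range (ψ (M + M)) ⊔ (⊤ : Submodule k (Matrix (Fin r) (Fin r) R)).map a := by
      symm
      rw [eq_top_iff]
      intro v _
      obtain ⟨c, u, h⟩ := hψ (M + M) v
      rw [h]
      refine Submodule.add_mem_sup ⟨c, rfl⟩ ⟨P' * u * Q', trivial, ?_⟩
      change P * (P' * u * Q') * Q = _
      calc P * (P' * u * Q') * Q = (P * P') * u * (Q' * Q) := by simp only [mul_assoc]
        _ = _ := by rw [hP, hQ, pow_add, mul_smul]; simp
    have e1 := Submodule.finrank_add_le_finrank_add_finrank (LinearMap.range (ψ (M + M)))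
      ((⊤ : Submodule k (Matrix (Fin r) (Fin r) R)).map a)
    rw [← htop] at e1
    have e2 := LinearMap.finrank_range_le (ψ (M + M))
    rw [Module.finrank_fintype_fun_eq_card] at e2
    simp only [Fintype.card_prod, Fintype.card_fin] at e2
    omega
  obtain ⟨y, _, hy⟩ := aux_pencil σ q hq hσ a b Z
    (by intro v; simp [a, Z]) (by intro v; ext; simp [b, Z, hτx]; ring)
    ⟨n, by ext1 v; rw [hZn, hn]; simp⟩ _ (r * (r * (M + M))) ⊤ ⊤ le_rfl hcod
    le_top le_top le_top le_top w trivial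
  rw [hZn] at hy
  exact ⟨y, hy⟩

end Abstract

section PS
open PowerSeries

variable {k : Type*} [Field k]

theorem aux_finite_level [IsAlgClosed k] (σ : k →+* k)
    [RingHomSurjective σ]
    (q : ℕ) (hq : (q : k) = 0) (hσ : ∀ x, σ x = x ^ q)
    {r : ℕ} (M n : ℕ) (P P' Q Q' : Matrix (Fin r) (Fin r) k⟦X⟧)
    (hP : P * P' = (X : k⟦X⟧) ^ M • (1 : Matrix (Fin r) (Fin r) k⟦X⟧))
    (hQ : Q' * Q = (X : k⟦X⟧) ^ M • (1 : Matrix (Fin r) (Fin r) k⟦X⟧))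
    (w : Matrix (Fin r) (Fin r) k⟦X⟧) :
    ∃ y w' : Matrix (Fin r) (Fin r) k⟦X⟧,
      (X : k⟦X⟧) ^ M • y.map (PowerSeries.map σ) - P * y * Q
        = (X : k⟦X⟧) ^ (r * (r * (M + M))) • w - (X : k⟦X⟧) ^ n • w' := by
  let I : Ideal k⟦X⟧ := Ideal.span {X ^ n}
  let π : k⟦X⟧ →+* k⟦X⟧ ⧸ I := Ideal.Quotient.mk I
  have hτI : I ≤ I.comap (PowerSeries.map σ) := by
    rw [Ideal.span_le, Set.singleton_subset_iff]
    change PowerSeries.map σ (X ^ n) ∈ I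
    rw [map_pow, PowerSeries.map_X]
    exact Ideal.subset_span rfl
  let τ : k⟦X⟧ ⧸ I →+* k⟦X⟧ ⧸ I := Ideal.quotientMap I (PowerSeries.map σ) hτI
  have hτπ : ∀ f, τ (π f) = π (PowerSeries.map σ f) := fun f => Ideal.quotientMap_mk
  have halg : ∀ c : k, algebraMap k (k⟦X⟧ ⧸ I) c = π (C c) := fun c => rfl
  have hmap : ∀ A B : Matrix (Fin r) (Fin r) k⟦X⟧, (A * B).map π = A.map π * B.map π :=
    fun A B => Matrix.map_mul
  have hsm : ∀ (f : k⟦X⟧) (B : Matrix (Fin r) (Fin r) k⟦X⟧), (f • B).map π = π f • B.map π := by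
    intro f B; ext; simp
  have h1 : (1 : Matrix (Fin r) (Fin r) k⟦X⟧).map π = 1 := by
    simp
  obtain ⟨y, hy⟩ := aux_core σ q hq hσ (π X) ⟨n, by
      rw [← map_pow]; exact Ideal.Quotient.eq_zero_iff_mem.mpr (Ideal.subset_span rfl)⟩
    (by
      intro f
      obtain ⟨f, rfl⟩ := Ideal.Quotient.mk_surjective f
      refine ⟨constantCoeff f, π (PowerSeries.mk fun p => coeff (p + 1) f), ?_⟩
      rw [halg, ← map_mul, ← map_add]
      congr 1
      rw [add_comm]
      exact PowerSeries.eq_X_mul_shift_add_const f)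
    τ (by
      intro c f
      obtain ⟨f, rfl⟩ := Ideal.Quotient.mk_surjective f
      rw [Algebra.smul_def, map_mul, Algebra.smul_def, halg, halg, hτπ, PowerSeries.map_C])
    (by rw [hτπ, PowerSeries.map_X]) M (P.map π) (P'.map π) (Q.map π) (Q'.map π)
    (by rw [← hmap, hP, hsm, h1, map_pow]) (by rw [← hmap, hQ, hsm, h1, map_pow]) (w.map π)
  choose y0 hy0 using fun i j => Ideal.Quotient.mk_surjective (y i j)
  have hyy : y = (Matrix.of y0).map π := by ext i j; exact (hy0 i j).symm
  set E : Matrix (Fin r) (Fin r) k⟦X⟧ := (X : k⟦X⟧) ^ (r * (r * (M + M))) • w -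
    ((X : k⟦X⟧) ^ M • (Matrix.of y0).map (PowerSeries.map σ) - P * (Matrix.of y0) * Q) with hE
  have hE0 : ∀ i j, (X : k⟦X⟧) ^ n ∣ E i j := by
    intro i j
    rw [← Ideal.mem_span_singleton]
    change _ ∈ I
    rw [← Ideal.Quotient.eq_zero_iff_mem]
    have : E.map π = 0 := by
      rw [hE, Matrix.map_sub _ (by intro a b; exact map_sub π a b),
        Matrix.map_sub _ (by intro a b; exact map_sub π a b), hsm, hsm, hmap, hmap, map_pow, map_pow,
        ← hy, hyy, sub_eq_zero]
      congr 2
    exact congrFun (congrFun this i) j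
  choose w' hw' using hE0
  refine ⟨Matrix.of y0, Matrix.of w', ?_⟩
  have : E = (X : k⟦X⟧) ^ n • Matrix.of w' := by ext1 i j; exact hw' i j
  rw [← this, hE]
  abel

theorem aux_complete [IsAlgClosed k] (σ : k →+* k)
    [RingHomSurjective σ]
    (q : ℕ) (hq : (q : k) = 0) (hσ : ∀ x, σ x = x ^ q)
    {r : ℕ} (M : ℕ) (P P' Q Q' : Matrix (Fin r) (Fin r) k⟦X⟧)
    (hP : P * P' = (X : k⟦X⟧) ^ M • (1 : Matrix (Fin r) (Fin r) k⟦X⟧))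
    (hQ : Q' * Q = (X : k⟦X⟧) ^ M • (1 : Matrix (Fin r) (Fin r) k⟦X⟧))
    (w : Matrix (Fin r) (Fin r) k⟦X⟧) :
    ∃ y : Matrix (Fin r) (Fin r) k⟦X⟧,
      (X : k⟦X⟧) ^ M • y.map (PowerSeries.map σ) - P * y * Q
        = (X : k⟦X⟧) ^ (r * (r * (M + M))) • w := by
  set D := r * (r * (M + M)) with hD
  let f : Matrix (Fin r) (Fin r) k⟦X⟧ → Matrix (Fin r) (Fin r) k⟦X⟧ := fun y =>
    (X : k⟦X⟧) ^ M • y.map (PowerSeries.map σ) - P * y * Q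
  have fadd : ∀ y y', f (y + y') = f y + f y' := by
    intro y y'
    simp only [f]
    rw [Matrix.map_add _ (by intro a b; exact map_add _ a b), mul_add, add_mul, smul_add]
    abel
  have fX : ∀ n y, f ((X : k⟦X⟧) ^ n • y) = (X : k⟦X⟧) ^ n • f y := by
    intro n y
    have : ((X : k⟦X⟧) ^ n • y).map (PowerSeries.map σ) = (X : k⟦X⟧) ^ n • y.map (PowerSeries.map σ) := by
      ext1 i j; simp
    simp only [f]
    rw [this, smul_sub, smul_comm]
    simp
  choose Y W hYW using fun w => aux_finite_level σ q hq hσ M (D + 1) P P' Q Q' hP hQ w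
  let ws : ℕ → Matrix (Fin r) (Fin r) k⟦X⟧ := fun n => W^[n] w
  have hws : ∀ n, f (Y (ws n)) = (X : k⟦X⟧) ^ D • ws n - (X : k⟦X⟧) ^ (D + 1) • ws (n + 1) := by
    intro n
    have : ws (n + 1) = W (ws n) := Function.iterate_succ_apply' W n w
    rw [this]
    exact hYW (ws n)
  let S : ℕ → Matrix (Fin r) (Fin r) k⟦X⟧ := fun s => ∑ n ∈ Finset.range s, (X : k⟦X⟧) ^ n • Y (ws n)
  have hSs : ∀ s, S (s + 1) = S s + (X : k⟦X⟧) ^ s • Y (ws s) := fun s => Finset.sum_range_succ _ _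
  have hfS : ∀ s, f (S s) = (X : k⟦X⟧) ^ D • w - (X : k⟦X⟧) ^ (D + s) • ws s := by
    intro s
    induction s with
    | zero =>
      have : f 0 = 0 := by simpa using fadd 0 0
      simp [S, this, ws]
    | succ s ih =>
      rw [hSs, fadd, fX, ih, hws, smul_sub, smul_smul, smul_smul]
      rw [show (X : k⟦X⟧) ^ s * X ^ D = X ^ (D + s) by ring,
        show (X : k⟦X⟧) ^ s * X ^ (D + 1) = X ^ (D + (s + 1)) by ring]
      abel
  let y : Matrix (Fin r) (Fin r) k⟦X⟧ := Matrix.of fun i j => PowerSeries.mk fun n => coeff n (S (n + 1) i j)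
  have hstab : ∀ i j n s, n < s → coeff n (S s i j) = coeff n (y i j) := by
    intro i j n s hns
    induction s, hns using Nat.le_induction with
    | base => simp [y]
    | succ s hs ih =>
      rw [hSs, Matrix.add_apply, map_add, ih, Matrix.smul_apply, smul_eq_mul,
        PowerSeries.coeff_X_pow_mul', if_neg (by omega), add_zero]
  have hdvd : ∀ s, ∃ u, y = S s + (X : k⟦X⟧) ^ s • u := by
    intro s
    have : ∀ i j, (X : k⟦X⟧) ^ s ∣ y i j - S s i j := by
      intro i j
      rw [PowerSeries.X_pow_dvd_iff]
      intro m hm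
      rw [map_sub, hstab i j m s hm, sub_self]
    choose u hu using this
    refine ⟨Matrix.of u, ?_⟩
    ext1 i j
    rw [Matrix.add_apply, Matrix.smul_apply, Matrix.of_apply, smul_eq_mul, ← hu]
    ring
  refine ⟨y, ?_⟩
  change f y = _
  ext i j n
  obtain ⟨u, hu⟩ := hdvd (n + 1)
  rw [hu, fadd, fX, hfS, Matrix.add_apply, Matrix.sub_apply, map_add, map_sub]
  rw [Matrix.smul_apply ((X : k⟦X⟧) ^ (D + (n + 1))), Matrix.smul_apply ((X : k⟦X⟧) ^ (n + 1)),
    smul_eq_mul, smul_eq_mul, PowerSeries.coeff_X_pow_mul', PowerSeries.coeff_X_pow_mul',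
    if_neg (by omega), if_neg (by omega)]
  simp

end PS

section Laurent

theorem aux_lift0 (x : LaurentSeries k) (hx : InPS x) :
    ∃ u : PowerSeries k, HahnSeries.ofPowerSeries ℤ k u = x := by
  refine ⟨PowerSeries.mk fun n => x.coeff n, ?_⟩
  ext m
  rw [PowerSeries.coeff_coe]
  split_ifs with hm
  · exact (hx m hm).symm
  · rw [PowerSeries.coeff_mk]
    congr 1
    omega

theorem aux_liftN (N : ℕ) (x : LaurentSeries k) (hx : InZPow (-(N : ℤ)) x) :
    ∃ u : PowerSeries k, HahnSeries.ofPowerSeries ℤ k u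
      = HahnSeries.ofPowerSeries ℤ k (PowerSeries.X ^ N) * x := by
  apply aux_lift0
  intro m hm
  rw [HahnSeries.ofPowerSeries_X_pow, HahnSeries.coeff_single_mul, hx _ (by omega), mul_zero]

theorem aux_liftP (n : ℕ) (x : LaurentSeries k) (hx : InZPow (n : ℤ) x) :
    ∃ u : PowerSeries k, HahnSeries.ofPowerSeries ℤ k (PowerSeries.X ^ n * u) = x := by
  obtain ⟨u, rfl⟩ := aux_lift0 x (fun m hm => hx m (by omega))
  have : (PowerSeries.X : PowerSeries k) ^ n ∣ u := by
    rw [PowerSeries.X_pow_dvd_iff]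
    intro m hm
    have := hx m (by omega)
    rwa [HahnSeries.ofPowerSeries_apply_coeff] at this
  obtain ⟨v, rfl⟩ := this
  exact ⟨v, rfl⟩

theorem aux_inPS (u : PowerSeries k) : InPS (HahnSeries.ofPowerSeries ℤ k u) := by
  intro m hm
  rw [PowerSeries.coeff_coe, if_pos hm]

theorem aux_inZPow (n : ℕ) (u : PowerSeries k) :
    InZPow (n : ℤ) (HahnSeries.ofPowerSeries ℤ k (PowerSeries.X ^ n * u)) := by
  intro m hm
  rw [map_mul, HahnSeries.ofPowerSeries_X_pow, HahnSeries.coeff_single_mul,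
    aux_inPS u _ (by omega), mul_zero]

theorem aux_inZPow_mono {m n : ℤ} (h : m ≤ n) {x : LaurentSeries k} (hx : InZPow n x) :
    InZPow m x := fun i hi => hx i (by omega)

theorem aux_frob (σ : k →+* k) (q : ℕ) (hq : q ≠ 0) (hσ : ∀ x, σ x = x ^ q) (u : PowerSeries k) :
    laurentFrob q (HahnSeries.ofPowerSeries ℤ k u)
      = HahnSeries.ofPowerSeries ℤ k (PowerSeries.map σ u) := by
  ext m
  rw [laurentFrob, dif_neg hq, HahnSeries.map_coeff, PowerSeries.coeff_coe, PowerSeries.coeff_coe]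
  split_ifs with hm
  · simp [hq]
  · simp [hσ]

end Laurent

/-- **Theorem A.1** for `G = GL_r`:  for every bounded subset `𝓑` of `GL_r(k((z)))` there is a
`c ∈ ℕ` such that for all `d ∈ ℕ`, `g ∈ 𝓑` and `h ∈ I_{d+c}` there is an `x ∈ I_d` with
`g·h = x⁻¹·g·σ(x)`. -/
theorem uniform_sigma_conjugation
    {p : ℕ} (hp : p.Prime) {e : ℕ} (he : 1 ≤ e) {q : ℕ} (hq : q = p ^ e)
    {k : Type*} [Field k] [IsAlgClosed k] [CharP k p]
    {r : ℕ} (hr : 1 ≤ r)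
    (𝓑 : Set (Matrix (Fin r) (Fin r) (LaurentSeries k)))
    (hGL : ∀ g ∈ 𝓑, IsUnit g)
    (hbounded : ∃ N : ℕ, ∀ g ∈ 𝓑, ∀ i j : Fin r,
      InZPow (-(N : ℤ)) (g i j) ∧ InZPow (-(N : ℤ)) (g⁻¹ i j)) :
    ∃ c : ℕ, ∀ d : ℕ, ∀ g ∈ 𝓑, ∀ h : Matrix (Fin r) (Fin r) (LaurentSeries k),
      InIwahori (d + c) h →
      ∃ x : Matrix (Fin r) (Fin r) (LaurentSeries k),
        InIwahori d x ∧ g * h = x⁻¹ * g * matFrob q x := by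
  obtain ⟨N, hN⟩ := hbounded
  have : Fact p.Prime := ⟨hp⟩
  have : ExpChar k p := ExpChar.prime hp
  let σ : k →+* k := (iterateFrobeniusEquiv k p e : k ≃+* k)
  have hσ : ∀ x, σ x = x ^ q := by
    intro x
    rw [hq]
    rfl
  have : RingHomSurjective σ := ⟨(iterateFrobeniusEquiv k p e).surjective⟩
  have hq0 : q ≠ 0 := by rw [hq]; exact pow_ne_zero _ hp.ne_zero
  have hqk : (q : k) = 0 := by
    rw [hq, Nat.cast_pow, CharP.cast_eq_zero, zero_pow (by omega)]
  refine ⟨r * (r * ((N + N) + (N + N))) + 1, ?_⟩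
  intro d g hg h hh
  set D := r * (r * ((N + N) + (N + N))) with hD
  obtain ⟨h1, h2, h3, h4, h5, h6⟩ := hh
  let ι : PowerSeries k →+* LaurentSeries k := HahnSeries.ofPowerSeries ℤ k
  have hιinj : Function.Injective ι := HahnSeries.ofPowerSeries_injective
  have hιMinj : Function.Injective
      (fun A : Matrix (Fin r) (Fin r) (PowerSeries k) => A.map ι) := by
    intro A B hAB
    ext1 i j
    exact hιinj (congrFun (congrFun hAB i) j)
  have hmul : ∀ A B : Matrix (Fin r) (Fin r) (PowerSeries k),
      (A * B).map ι = A.map ι * B.map ι := fun A B => Matrix.map_mul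
  have hsm : ∀ (f : PowerSeries k) (B : Matrix (Fin r) (Fin r) (PowerSeries k)),
      (f • B).map ι = ι f • B.map ι := by
    intro f B; ext1 i j; exact map_mul ι _ _
  have hone : (1 : Matrix (Fin r) (Fin r) (PowerSeries k)).map ι = 1 := by
    simp
  let X : PowerSeries k := PowerSeries.X
  have hgu := (Matrix.isUnit_iff_isUnit_det g).mp (hGL g hg)
  have hhu := (Matrix.isUnit_iff_isUnit_det h).mp h2
  choose G0 hG0 using fun i j => aux_liftN N (g i j) (hN g hg i j).1
  choose Gi hGi using fun i j => aux_liftN N (g⁻¹ i j) (hN g hg i j).2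
  choose H0 hH0 using fun i j => aux_lift0 (h i j) (h1 i j)
  choose Hi hHi using fun i j => aux_lift0 (h⁻¹ i j) (h3 i j)
  have eG0 : (Matrix.of G0).map ι = ι (X ^ N) • g := by ext1 i j; exact hG0 i j
  have eGi : (Matrix.of Gi).map ι = ι (X ^ N) • g⁻¹ := by ext1 i j; exact hGi i j
  have eH0 : (Matrix.of H0).map ι = h := by ext1 i j; exact hH0 i j
  have eHi : (Matrix.of Hi).map ι = h⁻¹ := by ext1 i j; exact hHi i j
  have hall : ∀ i j, InZPow ((d + (D + 1) : ℕ) : ℤ) ((h - 1) i j) := by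
    intro i j
    rcases lt_trichotomy i j with hij | hij | hij
    · rw [Matrix.sub_apply, Matrix.one_apply_ne hij.ne, sub_zero]
      exact h5 i j hij
    · subst hij
      rw [Matrix.sub_apply, Matrix.one_apply_eq]
      exact h4 i
    · rw [Matrix.sub_apply, Matrix.one_apply_ne hij.ne', sub_zero]
      exact aux_inZPow_mono (by omega) (h6 i j hij)
  choose W hW using fun i j => aux_liftP _ _ (hall i j)
  have eW : (X ^ (d + (D + 1)) • Matrix.of W).map ι = h - 1 := by ext1 i j; exact hW i j
  have hP : Matrix.of Gi * Matrix.of G0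
      = X ^ (N + N) • (1 : Matrix (Fin r) (Fin r) (PowerSeries k)) := by
    apply hιMinj
    simp only
    rw [hmul, hsm, hone, eG0, eGi, pow_add, map_mul, Matrix.smul_mul, Matrix.mul_smul,
      Matrix.nonsing_inv_mul g hgu, smul_smul]
  have hQ : (Matrix.of Hi * Matrix.of Gi) * (Matrix.of G0 * Matrix.of H0)
      = X ^ (N + N) • (1 : Matrix (Fin r) (Fin r) (PowerSeries k)) := by
    have : (Matrix.of Hi * Matrix.of Gi) * (Matrix.of G0 * Matrix.of H0)
        = Matrix.of Hi * (Matrix.of Gi * Matrix.of G0) * Matrix.of H0 := by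
      simp only [mul_assoc]
    rw [this, hP]
    apply hιMinj
    simp only
    rw [hmul, hmul, hsm, hone, eH0, eHi, Matrix.mul_smul, mul_one, Matrix.smul_mul,
      Matrix.nonsing_inv_mul h hhu]
  obtain ⟨y, hy⟩ := aux_complete σ q hqk hσ (N + N) _ _ _ _ hP hQ (X ^ (N + N) • Matrix.of W)
  set y0 : Matrix (Fin r) (Fin r) (PowerSeries k) := X ^ (d + 1) • y with hy0
  have hmapy0 : y0.map (PowerSeries.map σ) = X ^ (d + 1) • y.map (PowerSeries.map σ) := by
    ext1 i j
    simp [hy0, X]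
  have hy1 : X ^ (N + N) • y0.map (PowerSeries.map σ)
      - Matrix.of Gi * y0 * (Matrix.of G0 * Matrix.of H0)
      = X ^ (N + N) • (X ^ (d + (D + 1)) • Matrix.of W) := by
    have := congrArg (fun A => X ^ (d + 1) • A) hy
    simp only [smul_sub, smul_smul] at this
    rw [hmapy0, hy0, smul_smul, smul_smul, Matrix.mul_smul, Matrix.smul_mul]
    rw [show X ^ (N + N) * X ^ (d + 1) = X ^ (d + 1) * X ^ (N + N) by ring,
      show X ^ (N + N) * X ^ (d + (D + 1)) = X ^ (d + 1) * (X ^ D * X ^ (N + N)) by ring]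
    exact this
  have hz : ι (X ^ (N + N)) ≠ 0 := by
    rw [Ne, map_eq_zero_iff ι hιinj]
    exact pow_ne_zero _ PowerSeries.X_ne_zero
  have hy2 : (y0.map (PowerSeries.map σ)).map ι - g⁻¹ * y0.map ι * (g * h) = h - 1 := by
    have := congrArg (fun A : Matrix (Fin r) (Fin r) (PowerSeries k) => A.map ι) hy1
    rw [Matrix.map_sub _ (by intro a b; exact map_sub ι a b), hsm, hmul, hmul, hmul,
      hsm (X ^ (N + N)), eW, eG0, eGi, eH0] at this
    have e2 : (ι (X ^ N) • g⁻¹) * y0.map ι * ((ι (X ^ N) • g) * h)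
        = ι (X ^ (N + N)) • (g⁻¹ * y0.map ι * (g * h)) := by
      rw [pow_add, map_mul]
      simp only [Matrix.smul_mul, Matrix.mul_smul, smul_smul]
    rw [e2, ← smul_sub] at this
    exact smul_right_injective _ hz this
  let X0 : Matrix (Fin r) (Fin r) (PowerSeries k) := 1 + y0
  have hX0ι : X0.map ι = 1 + y0.map ι := by
    simp only [X0]
    rw [Matrix.map_add _ (by intro a b; exact map_add ι a b), hone]
  have hfrob : matFrob q (X0.map ι) = 1 + (y0.map (PowerSeries.map σ)).map ι := by
    have : matFrob q (X0.map ι) = (X0.map (PowerSeries.map σ)).map ι := by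
      ext1 i j
      exact aux_frob σ q hq0 hσ _
    rw [this]
    simp only [X0]
    rw [Matrix.map_add _ (by intro a b; exact map_add _ a b),
      Matrix.map_add _ (by intro a b; exact map_add _ a b)]
    simp
  have hdet : IsUnit X0.det := by
    rw [PowerSeries.isUnit_iff_constantCoeff]
    have e1 : PowerSeries.constantCoeff X0.det = 1 := by
      rw [RingHom.map_det]
      have : (PowerSeries.constantCoeff (R := k)).mapMatrix X0 = 1 := by
        rw [show X0 = 1 + y0 from rfl, map_add, map_one, add_eq_left]
        ext i j
        simp [hy0, X]
      rw [this, Matrix.det_one]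
    rw [e1]
    exact isUnit_one
  have hinv1 : X0.map ι * (X0⁻¹).map ι = 1 := by
    rw [← hmul, Matrix.mul_nonsing_inv X0 hdet, hone]
  have hinv : (X0.map ι)⁻¹ = (X0⁻¹).map ι := Matrix.inv_eq_right_inv hinv1
  have hXu : IsUnit (X0.map ι).det := Matrix.isUnit_det_of_right_inverse hinv1
  have hy0Z : ∀ i j, InZPow ((d : ℤ) + 1) (ι (y0 i j)) := by
    intro i j
    have := aux_inZPow (d + 1) (y i j)
    rw [Nat.cast_add, Nat.cast_one] at this
    exact this
  refine ⟨X0.map ι, ⟨fun i j => aux_inPS _, (Matrix.isUnit_iff_isUnit_det _).mpr hXu, ?_, ?_, ?_, ?_⟩,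
    ?_⟩
  · intro i j
    rw [hinv]
    exact aux_inPS _
  · intro i
    rw [hX0ι, Matrix.add_apply, Matrix.one_apply_eq, add_sub_cancel_left]
    exact aux_inZPow_mono (by omega) (hy0Z i i)
  · intro i j hij
    rw [hX0ι, Matrix.add_apply, Matrix.one_apply_ne hij.ne, zero_add]
    exact aux_inZPow_mono (by omega) (hy0Z i j)
  · intro i j hij
    rw [hX0ι, Matrix.add_apply, Matrix.one_apply_ne hij.ne', zero_add]
    exact hy0Z i j
  · have key : X0.map ι * (g * h) = g * matFrob q (X0.map ι) := by
      have hs : (y0.map (PowerSeries.map σ)).map ι = h - 1 + g⁻¹ * y0.map ι * (g * h) :=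
        sub_eq_iff_eq_add.mp hy2
      rw [hfrob, hX0ι, hs]
      rw [show g * (1 + (h - 1 + g⁻¹ * y0.map ι * (g * h)))
        = g * h + (g * g⁻¹) * (y0.map ι * (g * h)) by noncomm_ring, Matrix.mul_nonsing_inv g hgu,
        one_mul, add_mul, one_mul]
    rw [mul_assoc, ← key, ← mul_assoc, Matrix.nonsing_inv_mul _ hXu, one_mul]

end HVpaper
end
end

section
/- Let b ∈ GL_r(k((z))). Then there exists a natural number c_b such that for every natural number d and every g ∈ I_{d+c_b}, there exists x ∈ I_d with b·g = x⁻¹·b·σ(x). -/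
noncomputable section

open scoped Classical

namespace HVpaper

variable {A : Type*} [CommRing A]

variable {k : Type*} [Field k]

/-- Successive approximation in a complete filtered abelian group. -/
lemma approx_solve {V : Type*} [AddCommGroup V] (F : ℤ → AddSubgroup V)
    (hanti : ∀ a b : ℤ, a ≤ b → F b ≤ F a)
    (hsep : ∀ x : V, (∀ n, x ∈ F n) → x = 0)
    (hcomp : ∀ (M : ℤ) (s : ℕ → V), (∀ n : ℕ, s n ∈ F (M + n)) →
      ∃ y, ∀ J : ℕ, y - ∑ n ∈ Finset.range J, s n ∈ F (M + J))
    (T : V →+ V) (m C : ℤ) (hT : ∀ M x, x ∈ F M → T x ∈ F (M - m))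
    (hS : ∀ M h, h ∈ F M → ∃ y ∈ F (M - C), h - T y ∈ F (M + 1))
    (M : ℤ) (h : V) (hh : h ∈ F M) : ∃ y ∈ F (M - C), T y = h := by
  choose! S hS1 hS2 using hS
  let H : ℕ → V := fun n => Nat.rec h (fun n x => x - T (S (M + n) x)) n
  have H0 : H 0 = h := rfl
  have Hs : ∀ n : ℕ, H (n + 1) = H n - T (S (M + n) (H n)) := fun n => rfl
  have HF : ∀ n : ℕ, H n ∈ F (M + n) := by
    intro n
    induction n with
    | zero => simpa [H0] using hh
    | succ n ih =>
      have := hS2 _ _ ih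
      rw [Hs]
      convert this using 2
      push_cast
      ring
  obtain ⟨y, hy⟩ := hcomp (M - C) (fun n => S (M + n) (H n)) (by
    intro n
    have := hS1 _ _ (HF n)
    convert this using 2
    ring)
  refine ⟨y, by simpa using hy 0, ?_⟩
  have hsum : ∀ J : ℕ, h - T (∑ n ∈ Finset.range J, S (M + n) (H n)) = H J := by
    intro J
    induction J with
    | zero => simp [H0]
    | succ J ih => rw [Finset.sum_range_succ, map_add, Hs, ← ih]; abel
  rw [← sub_eq_zero]
  apply hsep
  intro n
  obtain ⟨J, hJ⟩ : ∃ J : ℕ, n ≤ M + J ∧ n ≤ M - C + J - m := by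
    refine ⟨(max (n - M) (n - M + C + m)).toNat, ?_, ?_⟩ <;> omega
  have h1 := hT _ _ (hy J)
  have h2 : T y - h = T (y - ∑ n ∈ Finset.range J, S (M + n) (H n)) - H J := by
    rw [← hsum, map_sub]; abel
  rw [h2]
  exact sub_mem (hanti _ _ hJ.2 h1) (hanti _ _ hJ.1 (HF J))

section scalar

/-- The filtration of `k((z))` by powers of `z`. -/
def zF (k : Type*) [Field k] (M : ℤ) : AddSubgroup (LaurentSeries k) where
  carrier := {x | InZPow M x}
  zero_mem' := by intro m _; simp
  add_mem' := by
    intro a b ha hb m hm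
    simp [ha m hm, hb m hm]
  neg_mem' := by
    intro a ha m hm
    simp [ha m hm]

lemma mem_zF {M : ℤ} {x : LaurentSeries k} : x ∈ zF k M ↔ ∀ m : ℤ, m < M → x.coeff m = 0 :=
  Iff.rfl

lemma zF_anti (a b : ℤ) (h : a ≤ b) : zF k b ≤ zF k a := fun _ hx m hm => hx m (by omega)

lemma zF_sep (x : LaurentSeries k) (h : ∀ n, x ∈ zF k n) : x = 0 := by
  ext m
  exact h (m + 1) m (by omega)

lemma zF_mul {a b : ℤ} {x y : LaurentSeries k} (hx : x ∈ zF k a) (hy : y ∈ zF k b) :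
    x * y ∈ zF k (a + b) := by
  intro m hm
  rw [HahnSeries.coeff_mul]
  apply Finset.sum_eq_zero
  intro ij hij
  have h := (Finset.mem_antidiagonal.1 hij).2.2
  by_cases h1 : ij.1 < a
  · simp [hx _ h1]
  · have h2 : ij.2 < b := by omega
    simp [hy _ h2]

lemma zF_one : (1 : LaurentSeries k) ∈ zF k 0 := by
  intro m hm
  rw [HahnSeries.coeff_one]
  simp [hm.ne]

lemma zF_exists (x : LaurentSeries k) : x ∈ zF k x.order :=
  fun _ hm => HahnSeries.coeff_eq_zero_of_lt_order hm

lemma zF_complete (M : ℤ) (s : ℕ → LaurentSeries k) (hs : ∀ n : ℕ, s n ∈ zF k (M + n)) :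
    ∃ y, ∀ J : ℕ, y - ∑ n ∈ Finset.range J, s n ∈ zF k (M + J) := by
  let f : ℤ → k := fun m => ∑ n ∈ Finset.range ((m - M).toNat + 1), (s n).coeff m
  have hf : ∀ m, m < M → f m = 0 := by
    intro m hm
    apply Finset.sum_eq_zero
    intro n _
    exact hs n m (by omega)
  have hbdd : BddBelow (Function.support f) :=
    ⟨M, fun m hm => not_lt.1 fun h => (Function.mem_support.1 hm) (hf m h)⟩
  refine ⟨HahnSeries.ofSuppBddBelow f hbdd, ?_⟩
  intro J m hm
  rw [HahnSeries.coeff_sub, HahnSeries.coeff_ofSuppBddBelow, HahnSeries.coeff_sum, sub_eq_zero]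
  by_cases hmM : m < M
  · rw [hf m hmM]
    symm
    apply Finset.sum_eq_zero
    intro n _
    exact hs n m (by omega)
  · apply Finset.sum_subset
    · intro n hn
      simp only [Finset.mem_range] at *
      omega
    · intro n _ hn
      simp only [Finset.mem_range] at *
      exact hs n m (by omega)

lemma exists_frobHom {p : ℕ} (hp : p.Prime) {e q : ℕ} (hq : q = p ^ e) [CharP k p] :
    ∃ s : LaurentSeries k →+* LaurentSeries k, (∀ x, laurentFrob q x = s x) ∧
      ∀ x n, (s x).coeff n = x.coeff n ^ q := by
  have : Fact p.Prime := ⟨hp⟩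
  have : ExpChar k p := ExpChar.prime hp
  have hq0 : q ≠ 0 := by rw [hq]; exact pow_ne_zero _ hp.ne_zero
  have hmap : ∀ x : LaurentSeries k, laurentFrob q x = x.map (iterateFrobenius k p e) := by
    intro x
    ext n
    rw [laurentFrob, dif_neg hq0]
    simp [iterateFrobenius_def, hq]
  refine ⟨
    { toFun := fun x => x.map (iterateFrobenius k p e)
      map_zero' := ?_
      map_one' := ?_
      map_add' := ?_
      map_mul' := ?_ }, hmap, ?_⟩
  · ext n
    by_cases h : n = 0 <;> simp [HahnSeries.coeff_one, h]
  · intro x y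
    exact HahnSeries.map_mul (iterateFrobenius k p e : k →ₙ+* k)
  · ext n; simp
  · intro x y
    ext n; simp
  · intro x n
    change (x.map (iterateFrobenius k p e)).coeff n = _
    simp [iterateFrobenius_def, hq]

lemma iter_coeff {q : ℕ} (s : LaurentSeries k →+* LaurentSeries k)
    (hs : ∀ x n, (s x).coeff n = x.coeff n ^ q) (i : ℕ) (x : LaurentSeries k) (n : ℤ) :
    (s^[i] x).coeff n = x.coeff n ^ (q ^ i) := by
  induction i with
  | zero => simp
  | succ i ih => rw [Function.iterate_succ_apply', hs, ih, ← pow_mul, pow_succ]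

lemma zF_iter {q : ℕ} (hq : 2 ≤ q) (s : LaurentSeries k →+* LaurentSeries k)
    (hs : ∀ x n, (s x).coeff n = x.coeff n ^ q) (i : ℕ) {x : LaurentSeries k} {M : ℤ}
    (hx : x ∈ zF k M) : s^[i] x ∈ zF k M := by
  intro m hm
  rw [iter_coeff s hs, hx m hm]
  exact zero_pow (by positivity)

lemma exists_additive_root [IsAlgClosed k] {q : ℕ} (hq : 2 ≤ q) (N : ℕ) (w : ℕ → ℕ)
    (hw : Set.InjOn w (Finset.range N)) (a : ℕ → k) (j0 : ℕ) (hj0 : j0 < N) (ha : a j0 ≠ 0)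
    (f : k) : ∃ y : k, ∑ j ∈ Finset.range N, a j * y ^ (q ^ w j) = f := by
  let P : Polynomial k :=
    ∑ j ∈ Finset.range N, Polynomial.C (a j) * Polynomial.X ^ (q ^ w j) - Polynomial.C f
  have hc : P.coeff (q ^ w j0) = a j0 := by
    have hne : q ^ w j0 ≠ 0 := by positivity
    simp only [P, Polynomial.coeff_sub, Polynomial.finsetSum_coeff, Polynomial.coeff_C_mul,
      Polynomial.coeff_X_pow, Polynomial.coeff_C_of_ne_zero hne, sub_zero]
    rw [Finset.sum_eq_single j0]
    · simp
    · intro j hj hjj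
      rw [if_neg, mul_zero]
      intro h
      exact hjj (hw hj (by simpa using hj0) (Nat.pow_right_injective hq h).symm)
    · intro h
      exact absurd (Finset.mem_range.2 hj0) h
  have hdeg : P.degree ≠ 0 := by
    intro h
    have h1 : P.coeff (q ^ w j0) = 0 := by
      apply Polynomial.coeff_eq_zero_of_degree_lt
      rw [h]
      have : 0 < q ^ w j0 := by positivity
      exact_mod_cast this
    exact ha (hc ▸ h1)
  obtain ⟨y, hy⟩ := IsAlgClosed.exists_root P hdeg
  refine ⟨y, ?_⟩
  have : P.eval y = 0 := hy
  simp only [P, Polynomial.eval_sub, Polynomial.eval_finsetSum, Polynomial.eval_mul,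
    Polynomial.eval_C, Polynomial.eval_pow, Polynomial.eval_X, sub_eq_zero] at this
  exact this

/-- Nonzero twisted polynomials in `σ` act surjectively on `k((z))`, with bounded loss. -/
lemma scalar_solve [IsAlgClosed k] {q : ℕ} (hq : 2 ≤ q)
    (s : LaurentSeries k →+* LaurentSeries k)
    (hs : ∀ x n, (s x).coeff n = x.coeff n ^ q) (N : ℕ) (w : ℕ → ℕ)
    (hw : Set.InjOn w (Finset.range N)) (c : ℕ → LaurentSeries k)
    (hc : ∃ j < N, c j ≠ 0) :
    ∃ C : ℤ, ∀ M : ℤ, ∀ f ∈ zF k M, ∃ t ∈ zF k (M - C),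
      ∑ j ∈ Finset.range N, c j * s^[w j] t = f := by
  obtain ⟨μ, hμ, j0, hj0, hne⟩ : ∃ μ : ℤ, (∀ j < N, c j ∈ zF k μ) ∧
      ∃ j0 < N, (c j0).coeff μ ≠ 0 := by
    obtain ⟨j1, hj1, hc1⟩ := hc
    obtain ⟨j0, hj0, hmin⟩ := Finset.exists_min_image
      ((Finset.range N).filter (fun j => c j ≠ 0)) (fun j => (c j).order)
      ⟨j1, by simp [hj1, hc1]⟩
    simp only [Finset.mem_filter, Finset.mem_range] at hj0 hmin
    refine ⟨(c j0).order, ?_, j0, hj0.1, ?_⟩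
    · intro j hj
      by_cases h0 : c j = 0
      · rw [h0]; exact zero_mem _
      · exact zF_anti _ _ (hmin j ⟨hj, h0⟩) (zF_exists _)
    · rw [Ne, HahnSeries.coeff_order_eq_zero]; exact hj0.2
  refine ⟨μ, ?_⟩
  let T : LaurentSeries k →+ LaurentSeries k :=
    { toFun := fun t => ∑ j ∈ Finset.range N, c j * s^[w j] t
      map_zero' := by simp
      map_add' := by
        intro x y
        rw [← Finset.sum_add_distrib]
        apply Finset.sum_congr rfl
        intro j _
        rw [iterate_map_add, mul_add] }
  have hTdef : ∀ t, T t = ∑ j ∈ Finset.range N, c j * s^[w j] t := fun _ => rfl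
  have hT : ∀ M x, x ∈ zF k M → T x ∈ zF k (M - -μ) := by
    intro M x hx
    rw [hTdef]
    apply sum_mem
    intro j hj
    have := zF_mul (hμ j (Finset.mem_range.1 hj)) (zF_iter hq s hs (w j) hx)
    rwa [show M - -μ = μ + M by ring]
  refine approx_solve (zF k) zF_anti zF_sep zF_complete T (-μ) μ hT ?_
  intro M h hh
  obtain ⟨y, hy⟩ := exists_additive_root hq N w hw (fun j => (c j).coeff μ) j0 hj0 hne
    (h.coeff M)
  have hsing : HahnSeries.single (M - μ) y ∈ zF k (M - μ) := by
    intro m hm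
    exact HahnSeries.coeff_single_of_ne hm.ne
  refine ⟨HahnSeries.single (M - μ) y, hsing, ?_⟩
  have hT' := hT _ _ hsing
  rw [show M - μ - -μ = M by ring] at hT'
  intro m hm
  by_cases hmM : m < M
  · exact (sub_mem hh hT') m hmM
  · have hmM : m = M := by omega
    subst hmM
    rw [HahnSeries.coeff_sub, sub_eq_zero, ← hy, hTdef, HahnSeries.coeff_sum]
    apply Finset.sum_congr rfl
    intro j _
    have : s^[w j] (HahnSeries.single (m - μ) y) = HahnSeries.single (m - μ) (y ^ (q ^ w j)) := by
      ext n
      rw [iter_coeff s hs]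
      by_cases hn : n = m - μ
      · simp [hn]
      · rw [HahnSeries.coeff_single_of_ne hn, HahnSeries.coeff_single_of_ne hn]
        exact zero_pow (by positivity)
    rw [this]
    have h3 := HahnSeries.coeff_mul_single_add (r := y ^ (q ^ w j)) (x := c j) (a := μ)
      (b := m - μ)
    rw [show μ + (m - μ) = m by ring] at h3
    exact h3.symm

end scalar

section matrix

variable {r : ℕ}

/-- The filtration of `M_r(k((z)))` by powers of `z`. -/
def mF (k : Type*) [Field k] (r : ℕ) (M : ℤ) :
    AddSubgroup (Matrix (Fin r) (Fin r) (LaurentSeries k)) where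
  carrier := {x | ∀ i j, x i j ∈ zF k M}
  zero_mem' := fun _ _ => zero_mem _
  add_mem' := fun ha hb i j => add_mem (ha i j) (hb i j)
  neg_mem' := fun ha i j => neg_mem (ha i j)

lemma mF_anti (a b : ℤ) (h : a ≤ b) : mF k r b ≤ mF k r a :=
  fun _ hx i j => zF_anti a b h (hx i j)

lemma mF_sep (x : Matrix (Fin r) (Fin r) (LaurentSeries k)) (h : ∀ n, x ∈ mF k r n) : x = 0 := by
  ext1 i j
  exact zF_sep _ fun n => h n i j

lemma mF_complete (M : ℤ) (s : ℕ → Matrix (Fin r) (Fin r) (LaurentSeries k))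
    (hs : ∀ n : ℕ, s n ∈ mF k r (M + n)) :
    ∃ y, ∀ J : ℕ, y - ∑ n ∈ Finset.range J, s n ∈ mF k r (M + J) := by
  have h := fun i j => zF_complete M (fun n => s n i j) (fun n => hs n i j)
  choose y hy using h
  refine ⟨Matrix.of y, fun J i j => ?_⟩
  have := hy i j J
  simpa [Matrix.sum_apply] using this

lemma mF_mul {a b : ℤ} {x y : Matrix (Fin r) (Fin r) (LaurentSeries k)}
    (hx : x ∈ mF k r a) (hy : y ∈ mF k r b) : x * y ∈ mF k r (a + b) := by
  intro i j
  rw [Matrix.mul_apply]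
  exact sum_mem fun l _ => zF_mul (hx i l) (hy l j)

lemma mF_smul {a b : ℤ} {x : LaurentSeries k} {y : Matrix (Fin r) (Fin r) (LaurentSeries k)}
    (hx : x ∈ zF k a) (hy : y ∈ mF k r b) : x • y ∈ mF k r (a + b) :=
  fun i j => zF_mul hx (hy i j)

lemma mF_one : (1 : Matrix (Fin r) (Fin r) (LaurentSeries k)) ∈ mF k r 0 := by
  intro i j
  rw [Matrix.one_apply]
  split_ifs
  · exact zF_one
  · exact zero_mem _

lemma finset_lower {ι : Type*} (t : Finset ι) (f : ι → ℤ) : ∃ B : ℤ, B ≤ 0 ∧ ∀ i ∈ t, B ≤ f i := by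
  induction t using Finset.induction_on with
  | empty => exact ⟨0, le_refl _, by simp⟩
  | insert a t _ ih =>
    obtain ⟨B, hB0, hB⟩ := ih
    refine ⟨min B (f a), by omega, fun i hi => ?_⟩
    rcases Finset.mem_insert.1 hi with rfl | hi
    · exact min_le_right _ _
    · exact (min_le_left _ _).trans (hB i hi)

lemma mF_exists (x : Matrix (Fin r) (Fin r) (LaurentSeries k)) : ∃ B : ℤ, B ≤ 0 ∧ x ∈ mF k r B := by
  obtain ⟨B, h0, hB⟩ := finset_lower (Finset.univ : Finset (Fin r × Fin r))
    (fun ij => (x ij.1 ij.2).order)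
  exact ⟨B, h0, fun i j => zF_anti _ _ (hB (i, j) (Finset.mem_univ _)) (zF_exists _)⟩

/-- Solving `Φ y - y = f e` for a fixed `e` and all scalars `f`, with bounded loss. -/
lemma cyclic_solve [IsAlgClosed k] {q : ℕ} (hq : 2 ≤ q)
    (s : LaurentSeries k →+* LaurentSeries k)
    (hs : ∀ x n, (s x).coeff n = x.coeff n ^ q)
    (Φ : Matrix (Fin r) (Fin r) (LaurentSeries k) →+ Matrix (Fin r) (Fin r) (LaurentSeries k))
    (hΦ : ∀ (f : LaurentSeries k) v, Φ (f • v) = s f • Φ v)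
    (e : Matrix (Fin r) (Fin r) (LaurentSeries k)) :
    ∃ C : ℤ, ∀ M : ℤ, ∀ f ∈ zF k M, ∃ y ∈ mF k r (M - C), Φ y - y = f • e := by
  obtain ⟨n, a, ha0, hane⟩ : ∃ (n : ℕ) (a : ℕ → LaurentSeries k),
      ∑ i ∈ Finset.range (n + 1), a i • Φ^[i] e = 0 ∧ ∃ i < n + 1, a i ≠ 0 := by
    let n := Module.finrank (LaurentSeries k) (Matrix (Fin r) (Fin r) (LaurentSeries k))
    have hli : ¬ LinearIndependent (LaurentSeries k) (fun i : Fin (n + 1) => Φ^[(i : ℕ)] e) := by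
      intro h
      have := h.fintype_card_le_finrank
      simp [n] at this
    obtain ⟨g, hg, i, hi⟩ := Fintype.not_linearIndependent_iff.1 hli
    refine ⟨n, fun j => if h : j < n + 1 then g ⟨j, h⟩ else 0, ?_, i, i.2, ?_⟩
    · rw [Finset.sum_range]
      rw [← hg]
      apply Finset.sum_congr rfl
      intro j _
      beta_reduce
      rw [dif_pos j.2]
    · beta_reduce
      rw [dif_pos i.2]
      exact hi
  have hsinj : Function.Injective s := s.injective
  obtain ⟨C, hC⟩ := scalar_solve hq s hs (n + 1) (fun j => n - j)
    (by
      intro i hi j hj h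
      simp only [Finset.coe_range, Set.mem_Iio] at hi hj h
      omega)
    (fun j => s^[n - j] (a j))
    (by
      obtain ⟨i, hi, hai⟩ := hane
      refine ⟨i, hi, fun h => hai ?_⟩
      apply hsinj.iterate (n - i)
      simp [h])
  obtain ⟨A, hA0, hA⟩ := finset_lower (Finset.range (n + 1)) (fun i => (a i).order)
  obtain ⟨E, hE0, hE⟩ : ∃ E : ℤ, E ≤ 0 ∧ ∀ i < n + 1, Φ^[i] e ∈ mF k r E := by
    choose B hB using fun i => mF_exists (Φ^[i] e)
    obtain ⟨E, hE0, hE⟩ := finset_lower (Finset.range (n + 1)) B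
    exact ⟨E, hE0, fun i hi => mF_anti _ _ (hE i (Finset.mem_range.2 hi)) (hB i).2⟩
  refine ⟨max 0 (C - A) - E, fun M f hf => ?_⟩
  obtain ⟨t, ht, hteq⟩ := hC M (-(s^[n] f)) (neg_mem (zF_iter hq s hs n hf))
  let y : ℕ → LaurentSeries k :=
    fun i => Nat.rec (-f - t * a 0) (fun i x => s x - t * a (i + 1)) i
  have y0 : y 0 = -f - t * a 0 := rfl
  have ys : ∀ i, y (i + 1) = s (y i) - t * a (i + 1) := fun _ => rfl
  have hclosed : ∀ m, y m = -(s^[m] f) - ∑ j ∈ Finset.range (m + 1), s^[m - j] (t * a j) := by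
    intro m
    induction m with
    | zero => simp [y0]
    | succ m ih =>
      rw [ys, ih, Finset.sum_range_succ _ (m + 1), map_sub, map_neg, map_sum,
        Function.iterate_succ_apply']
      have : ∑ j ∈ Finset.range (m + 1), s (s^[m - j] (t * a j)) =
          ∑ j ∈ Finset.range (m + 1), s^[m + 1 - j] (t * a j) := by
        apply Finset.sum_congr rfl
        intro j hj
        have : m + 1 - j = (m - j) + 1 := by
          have := Finset.mem_range.1 hj
          omega
        rw [this, Function.iterate_succ_apply']
      rw [this]
      simp
      ring
  have hyn : y n = 0 := by
    rw [hclosed, ← hteq, sub_eq_zero]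
    apply Finset.sum_congr rfl
    intro j _
    rw [iterate_map_mul, mul_comm]
  have hta : ∀ i < n + 1, t * a i ∈ zF k (M - max 0 (C - A)) := by
    intro i hi
    refine zF_anti _ _ ?_ (zF_mul ht (zF_exists (a i)))
    have := hA i (Finset.mem_range.2 hi)
    omega
  have hyF : ∀ i < n + 1, y i ∈ zF k (M - max 0 (C - A)) := by
    intro i
    induction i with
    | zero =>
      intro h
      rw [y0]
      exact sub_mem (neg_mem (zF_anti _ _ (by omega) hf)) (hta 0 h)
    | succ i ih =>
      intro h
      rw [ys]
      exact sub_mem (zF_iter hq s hs 1 (ih (by omega))) (hta _ h)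
  have htel : ∀ m, Φ (∑ i ∈ Finset.range m, y i • Φ^[i] e) - ∑ i ∈ Finset.range m, y i • Φ^[i] e
      = f • e + t • ∑ i ∈ Finset.range (m + 1), a i • Φ^[i] e + y m • Φ^[m] e := by
    intro m
    induction m with
    | zero =>
      simp only [Finset.range_zero, Finset.sum_empty, map_zero, zero_add, Finset.range_one,
        Finset.sum_singleton, y0, Function.iterate_zero, id, sub_smul, neg_smul, mul_smul]
      abel
    | succ m ih =>
      rw [Finset.sum_range_succ, map_add, hΦ, Finset.sum_range_succ _ (m + 1), ys, smul_add,
        ← Function.iterate_succ_apply' Φ, sub_smul, mul_smul, add_sub_add_comm, ih]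
      abel
  refine ⟨∑ i ∈ Finset.range n, y i • Φ^[i] e, ?_, ?_⟩
  · apply sum_mem
    intro i hi
    have hi := Finset.mem_range.1 hi
    have := mF_smul (hyF i (by omega)) (hE i (by omega))
    rwa [show M - (max 0 (C - A) - E) = M - max 0 (C - A) + E by ring]
  · rw [htel, ha0, hyn]
    simp

lemma full_solve [IsAlgClosed k] {q : ℕ} (hq : 2 ≤ q)
    (s : LaurentSeries k →+* LaurentSeries k)
    (hs : ∀ x n, (s x).coeff n = x.coeff n ^ q)
    (Φ : Matrix (Fin r) (Fin r) (LaurentSeries k) →+ Matrix (Fin r) (Fin r) (LaurentSeries k))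
    (hΦ : ∀ (f : LaurentSeries k) v, Φ (f • v) = s f • Φ v) :
    ∃ C : ℤ, 0 ≤ C ∧ ∀ M : ℤ, ∀ h ∈ mF k r M, ∃ y ∈ mF k r (M - C), Φ y - y = h := by
  choose C hC using fun ij : Fin r × Fin r =>
    cyclic_solve hq s hs Φ hΦ (Matrix.single ij.1 ij.2 1)
  obtain ⟨B, hB0, hB⟩ := finset_lower Finset.univ (fun ij => - C ij)
  refine ⟨-B, by omega, fun M h hh => ?_⟩
  choose y hy hyeq using fun ij : Fin r × Fin r => hC ij M (h ij.1 ij.2) (hh ij.1 ij.2)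
  refine ⟨∑ ij, y ij, ?_, ?_⟩
  · apply sum_mem
    intro ij hij
    refine mF_anti _ _ ?_ (hy ij)
    have := hB ij hij
    omega
  · rw [map_sum, ← Finset.sum_sub_distrib]
    simp only [hyeq]
    rw [Fintype.sum_prod_type]
    conv_rhs => rw [Matrix.matrix_eq_sum_single h]
    simp [Matrix.smul_single]

lemma exists_integral_inverse (y : Matrix (Fin r) (Fin r) (LaurentSeries k)) (hy : y ∈ mF k r 1) :
    ∃ w ∈ mF k r 0, (1 + y) * w = 1 := by
  have := approx_solve (mF k r) mF_anti mF_sep mF_complete (AddMonoidHom.mulLeft (1 + y)) 0 0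
    (by
      intro M x hx
      rw [AddMonoidHom.coe_mulLeft, add_mul, one_mul, sub_zero]
      exact add_mem hx (mF_anti _ _ (by omega) (mF_mul hy hx)))
    (by
      intro M h hh
      refine ⟨h, by simpa using hh, ?_⟩
      rw [AddMonoidHom.coe_mulLeft, add_mul, one_mul, sub_add_cancel_left, add_comm M]
      exact neg_mem (mF_mul hy hh))
    0 1 mF_one
  simpa using this

lemma inIwahori_of_mF (d : ℕ) (y : Matrix (Fin r) (Fin r) (LaurentSeries k))
    (hy : y ∈ mF k r (d + 1)) : IsUnit (1 + y) ∧ InIwahori d (1 + y) := by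
  obtain ⟨w, hw, hyw⟩ := exists_integral_inverse y (mF_anti _ _ (by omega) hy)
  have hu : IsUnit (1 + y) := IsUnit.of_mul_eq_one w hyw
  have h0 : 1 + y ∈ mF k r 0 := add_mem mF_one (mF_anti _ _ (by omega) hy)
  refine ⟨hu, fun i j => h0 i j, hu, ?_, ?_, ?_, ?_⟩
  · rw [Matrix.inv_eq_right_inv hyw]
    exact fun i j => hw i j
  · intro i
    rw [Matrix.add_apply, Matrix.one_apply_eq, add_sub_cancel_left]
    exact zF_anti _ _ (by omega) (hy i i)
  · intro i j hij
    rw [Matrix.add_apply, Matrix.one_apply_ne hij.ne, zero_add]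
    exact zF_anti _ _ (by omega) (hy i j)
  · intro i j hij
    rw [Matrix.add_apply, Matrix.one_apply_ne hij.ne', zero_add]
    exact hy i j

lemma mF_of_inIwahori (n : ℕ) (g : Matrix (Fin r) (Fin r) (LaurentSeries k))
    (hg : InIwahori n g) : g - 1 ∈ mF k r n := by
  obtain ⟨-, -, -, h1, h2, h3⟩ := hg
  intro i j
  rw [Matrix.sub_apply]
  rcases lt_trichotomy i j with h | rfl | h
  · rw [Matrix.one_apply_ne h.ne, sub_zero]
    exact h2 i j h
  · rw [Matrix.one_apply_eq]
    exact h1 i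
  · rw [Matrix.one_apply_ne h.ne', sub_zero]
    exact zF_anti _ _ (by omega) (h3 i j h)

end matrix

/-- **Lemma A.2** for `G = GL_r`:  for every `b ∈ GL_r(k((z)))` there is a `c_b ∈ ℕ` such that
for all `d ∈ ℕ` and `g ∈ I_{d+c_b}` there is an `x ∈ I_d` with `b·g = x⁻¹·b·σ(x)`. -/
theorem sigma_conjugation_of_iwahori_perturbation
    {p : ℕ} (hp : p.Prime) {e : ℕ} (he : 1 ≤ e) {q : ℕ} (hq : q = p ^ e)
    {k : Type*} [Field k] [IsAlgClosed k] [CharP k p]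
    {r : ℕ} (hr : 1 ≤ r)
    (b : Matrix (Fin r) (Fin r) (LaurentSeries k)) (hb : IsUnit b) :
    ∃ c : ℕ, ∀ d : ℕ, ∀ g : Matrix (Fin r) (Fin r) (LaurentSeries k),
      InIwahori (d + c) g →
      ∃ x : Matrix (Fin r) (Fin r) (LaurentSeries k),
        InIwahori d x ∧ b * g = x⁻¹ * b * matFrob q x := by
  have hq2 : 2 ≤ q := by
    rw [hq]
    calc 2 ≤ p := hp.two_le
      _ = p ^ 1 := (pow_one p).symm
      _ ≤ p ^ e := Nat.pow_le_pow_right hp.pos he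
  obtain ⟨s, hsq, hs⟩ := exists_frobHom (k := k) hp hq
  have hmat : ∀ x : Matrix (Fin r) (Fin r) (LaurentSeries k),
      matFrob q x = s.mapMatrix x := by
    intro x
    ext1 i j
    simp [matFrob, hsq]
  have hdet : IsUnit b.det := (Matrix.isUnit_iff_isUnit_det b).1 hb
  let Φ : Matrix (Fin r) (Fin r) (LaurentSeries k) →+ Matrix (Fin r) (Fin r) (LaurentSeries k) :=
    { toFun := fun x => b * s.mapMatrix x * b⁻¹
      map_zero' := by simp
      map_add' := by intro x y; rw [map_add, mul_add, add_mul] }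
  have hΦdef : ∀ x, Φ x = b * s.mapMatrix x * b⁻¹ := fun _ => rfl
  have hΦ : ∀ (f : LaurentSeries k) v, Φ (f • v) = s f • Φ v := by
    intro f v
    have : s.mapMatrix (f • v) = s f • s.mapMatrix v := by
      ext1 i j
      simp
    rw [hΦdef, hΦdef, this, Matrix.mul_smul, Matrix.smul_mul]
  obtain ⟨C, hC0, hC⟩ := full_solve hq2 s hs Φ hΦ
  obtain ⟨B1, hB1, hbB1⟩ := mF_exists b
  obtain ⟨B2, hB2, hbB2⟩ := mF_exists b⁻¹
  have hΦF : ∀ M x, x ∈ mF k r M → Φ x ∈ mF k r (M + B1 + B2) := by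
    intro M x hx
    have h1 : s.mapMatrix x ∈ mF k r M := fun i j => zF_iter hq2 s hs 1 (hx i j)
    have h2 := mF_mul (mF_mul hbB1 h1) hbB2
    rwa [add_comm B1 M] at h2
  refine ⟨(C + 1 - B1 - B2).toNat, fun d g hg => ?_⟩
  have hh := mF_of_inIwahori _ _ hg
  set H := b * (g - 1) * b⁻¹ with hH
  have hHF : H ∈ mF k r (d + C + 1) :=
    mF_anti _ _ (by push_cast; omega) (mF_mul (mF_mul hbB1 hh) hbB2)
  obtain ⟨y, hy, hyeq⟩ := approx_solve (mF k r) mF_anti mF_sep mF_complete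
    (Φ - AddMonoidHom.id _ - AddMonoidHom.mulRight H) (-(B1 + B2)) C
    (by
      intro M x hx
      simp only [AddMonoidHom.sub_apply, AddMonoidHom.id_apply, AddMonoidHom.coe_mulRight]
      exact sub_mem (sub_mem (mF_anti _ _ (by omega) (hΦF M x hx)) (mF_anti _ _ (by omega) hx))
        (mF_anti _ _ (by omega) (mF_mul hx hHF)))
    (by
      intro M h hhM
      obtain ⟨y, hy, hyeq⟩ := hC M h hhM
      refine ⟨y, hy, ?_⟩
      simp only [AddMonoidHom.sub_apply, AddMonoidHom.id_apply, AddMonoidHom.coe_mulRight]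
      rw [hyeq, sub_sub_cancel]
      exact mF_anti _ _ (by omega) (mF_mul hy hHF))
    _ H hHF
  simp only [AddMonoidHom.sub_apply, AddMonoidHom.id_apply, AddMonoidHom.coe_mulRight] at hyeq
  obtain ⟨hu, hI⟩ := inIwahori_of_mF d y (mF_anti _ _ (by omega) hy)
  refine ⟨1 + y, hI, ?_⟩
  have hudet := (Matrix.isUnit_iff_isUnit_det _).1 hu
  have hHb : H * b = b * (g - 1) := by
    rw [hH, mul_assoc, Matrix.nonsing_inv_mul b hdet, mul_one]
  have hΦb : Φ y * b = b * s.mapMatrix y := by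
    rw [hΦdef, mul_assoc, Matrix.nonsing_inv_mul b hdet, mul_one]
  have hkey : (1 + y) * (b * g) = b * matFrob q (1 + y) := by
    have h1 : Φ y = y + (1 + y) * H := by
      rw [add_mul, one_mul]
      rw [sub_sub, sub_eq_iff_eq_add] at hyeq
      rw [hyeq]
      abel
    have h2 : b * s.mapMatrix y = y * b + (1 + y) * (b * (g - 1)) := by
      rw [← hΦb, h1, add_mul, mul_assoc, hHb]
    rw [hmat, map_add, map_one, mul_add b, h2]
    noncomm_ring
  rw [mul_assoc, ← hkey, ← mul_assoc (1 + y)⁻¹, Matrix.nonsing_inv_mul _ hudet, one_mul]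

end HVpaper
end
end

section
/- Let μ = (d₁ ≥ … ≥ d_r ≥ 0) and μ′ = (d′₁ ≥ … ≥ d′_r ≥ 0) be nonincreasing tuples of nonnegative integers. Then there exists c ∈ ℕ, depending only on μ and μ′ (with r, q and k fixed), with the following property: whenever b ∈ M_r(k⟦z⟧) is an effective local shtuka bounded by μ, b′ ∈ M_r(k⟦z⟧) is an effective local shtuka bounded by μ′, d ∈ ℕ, and g ∈ M_r(k⟦z⟧) satisfies b′·σ(g) − g·b ∈ z^{c+d}·M_r(k⟦z⟧), there exists f ∈ M_r(k⟦z⟧) with f·b = b′·σ(f) and f − g ∈ z^{d}·M_r(k⟦z⟧). -/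
noncomputable section

open scoped Classical

namespace HVpaper

variable {A : Type*} [CommRing A]

/-- `u` is a unit of the subring `A⟦z⟧` of `A((z))`. -/
def IsPSUnit (u : LaurentSeries A) : Prop :=
  InPS u ∧ ∃ v : LaurentSeries A, InPS v ∧ u * v = 1

/-- The element `z^n` of `A((z))`. -/
def zPow (n : ℤ) : LaurentSeries A :=
  HahnSeries.single n 1

/-- The coefficientwise map on Laurent series induced by a ring homomorphism. -/
def lmap {B : Type*} [CommRing B] (f : A →+* B) (x : LaurentSeries A) : LaurentSeries B :=
  x.map f

variable {k : Type*} [Field k]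

/-- The sum of the `i` smallest (i.e. last `i`) entries of the nonincreasing tuple `μ`. -/
def lowSum {r : ℕ} (μ : Fin r → ℤ) (i : ℕ) : ℤ :=
  ∑ j : Fin r, if r ≤ (j : ℕ) + i then μ j else 0

/-- The matrix `M` over `A((z))` is bounded by the dominant cocharacter
`μ = (μ 0 ≥ … ≥ μ (r-1))` of `GL_r`: for each `1 ≤ i ≤ r` every `i×i` minor of `M` lies in
`z^(μ_{r-i+1}+⋯+μ_r)·A⟦z⟧` and `det M = z^(μ_1+⋯+μ_r)` times a unit of `A⟦z⟧`. -/
def BoundedBy {r : ℕ} (μ : Fin r → ℤ) (M : Matrix (Fin r) (Fin r) (LaurentSeries A)) : Prop :=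
  (∀ i : Fin r, ∀ ri ci : Fin ((i : ℕ) + 1) → Fin r,
    InZPow (lowSum μ ((i : ℕ) + 1)) ((M.submatrix ri ci).det)) ∧
  (∃ u : LaurentSeries A, IsPSUnit u ∧ M.det = zPow (∑ j, μ j) * u)

section Abstract

variable {k : Type*} [Field k] {W : Type*} [AddCommGroup W] [Module k W]

lemma aux_poly [IsAlgClosed k] (q : ℕ) (hq0 : (q : k) = 0) (a : ℕ → k) (n : ℕ) :
    ∃ x : ℕ → k, x 0 = a 0 * x n ^ q - 1 ∧ ∀ i, x (i + 1) = x i ^ q + a (i + 1) * x n ^ q := by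
  let P : ℕ → Polynomial k := fun i => Nat.rec (Polynomial.C (a 0) * Polynomial.X ^ q - 1)
    (fun i Q => Q ^ q + Polynomial.C (a (i + 1)) * Polynomial.X ^ q) i
  have hder : ∀ i, Polynomial.derivative (P i) = 0 := by
    intro i
    cases i with
    | zero => simp [P, Polynomial.derivative_pow, hq0]
    | succ i => simp [P, Polynomial.derivative_pow, hq0]
  have hdeg : (P n - Polynomial.X).degree ≠ 0 := by
    intro h
    have h1 := Polynomial.eq_C_of_degree_eq_zero h
    have h2 := congrArg Polynomial.derivative h1
    simp [hder] at h2
  obtain ⟨t, ht⟩ := IsAlgClosed.exists_root _ hdeg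
  have ht' : (P n).eval t = t := by
    have : (P n - Polynomial.X).eval t = 0 := ht
    simpa [sub_eq_zero] using this
  refine ⟨fun i => (P i).eval t, ?_, ?_⟩
  · simp only [ht']
    simp [P]
  · intro i
    simp only [ht']
    simp [P]

lemma aux_sum (q : ℕ) (a x : ℕ → k) (t : k) (h : ℕ → W) (h0 : x 0 = a 0 * t ^ q - 1)
    (hs : ∀ i, x (i + 1) = x i ^ q + a (i + 1) * t ^ q) (n : ℕ) :
    ∑ i ∈ Finset.range (n + 1), x i • h i =
      t ^ q • ∑ i ∈ Finset.range (n + 1), a i • h i - h 0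
        + ∑ i ∈ Finset.range n, x i ^ q • h (i + 1) := by
  induction n with
  | zero => simp [h0, sub_smul, smul_smul, mul_comm]
  | succ n ih =>
    rw [Finset.sum_range_succ, ih, Finset.sum_range_succ _ (n + 1),
      Finset.sum_range_succ (fun i => x i ^ q • h (i + 1)) n, hs, smul_add, add_smul, smul_smul,
      mul_comm (t ^ q)]
    abel

lemma aux_lang_s2 [IsAlgClosed k] [FiniteDimensional k W] (q : ℕ) (hq0 : (q : k) = 0)
    (σ : k →+* k) (hσ : ∀ a, σ a = a ^ q) (Φ : W →ₛₗ[σ] W) (Ψ : W →ₗ[k] W)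
    (X U : Submodule k W) (hΦ : ∀ x ∈ X, Φ x ∈ U) (hΨ : ∀ u ∈ U, ∃ x ∈ X, Ψ x = u) :
    ∀ h ∈ U, ∃ x ∈ X, Φ x - Ψ x = h := by
  intro h₀ hh₀
  choose! s hsX hs using hΨ
  let h : ℕ → W := fun i => Nat.rec h₀ (fun _ w => Φ (s w)) i
  have hU : ∀ i, h i ∈ U := by
    intro i
    induction i with
    | zero => exact hh₀
    | succ i ih => exact hΦ _ (hsX _ ih)
  have hsucc : ∀ i, h (i + 1) = Φ (s (h i)) := fun i => rfl
  let S : ℕ →o Submodule k W :=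
    ⟨fun n => Submodule.span k (h '' (Finset.range n : Set ℕ)), fun m n hmn =>
      Submodule.span_mono (Set.image_mono (by simpa using hmn))⟩
  obtain ⟨n, hn⟩ := monotone_stabilizes_iff_noetherian.2 (inferInstance : IsNoetherian k W) S
  have hmem : h n ∈ S n := by
    rw [hn (n + 1) (Nat.le_succ n)]
    exact Submodule.subset_span ⟨n, by simp, rfl⟩
  have hmem' : h n ∈ Submodule.span k (h '' (Finset.range n : Set ℕ)) := hmem
  rw [Submodule.mem_span_image_finset_iff_exists_fun] at hmem'
  obtain ⟨c, hc⟩ := hmem'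
  let a : ℕ → k := fun i => if hi : i ∈ Finset.range n then c ⟨i, hi⟩ else 0
  have ha : ∑ i ∈ Finset.range n, a i • h i = h n := by
    rw [← hc, ← Finset.sum_coe_sort]
    refine Finset.sum_congr rfl fun i _ => ?_
    have := i.2
    simp only [a, dif_pos this]
  cases n with
  | zero =>
    refine ⟨0, X.zero_mem, ?_⟩
    have h1 : (0 : W) = h 0 := by simpa using ha
    have : h₀ = 0 := h1.symm
    simp [this]
  | succ n =>
    obtain ⟨x, hx0, hxs⟩ := aux_poly q hq0 a n
    have key := aux_sum q a x (x n) h hx0 hxs n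
    refine ⟨∑ i ∈ Finset.range (n + 1), x i • s (h i),
      X.sum_mem fun i _ => X.smul_mem _ (hsX _ (hU i)), ?_⟩
    have e1 : Φ (∑ i ∈ Finset.range (n + 1), x i • s (h i))
        = ∑ i ∈ Finset.range (n + 1), x i ^ q • h (i + 1) := by
      simp [map_sum, hσ, hsucc]
    have e2 : Ψ (∑ i ∈ Finset.range (n + 1), x i • s (h i))
        = ∑ i ∈ Finset.range (n + 1), x i • h i := by
      rw [map_sum]
      exact Finset.sum_congr rfl fun i _ => by rw [map_smul, hs _ (hU i)]
    rw [e1, e2, key, ha, Finset.sum_range_succ]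
    show _ = h 0
    abel

lemma aux_nilp [FiniteDimensional k W] (Z : W →ₗ[k] W) (m : ℕ) (hZ : ∀ x, (Z ^ m) x = 0)
    (S : Submodule k W) (hS : ∀ x ∈ S, Z x ∈ S) (s : ℕ) :
    ∀ U : Submodule k W, S ≤ U → (∀ x ∈ U, Z x ∈ U) →
      Module.finrank k U ≤ s + Module.finrank k S → ∀ h ∈ U, (Z ^ s) h ∈ S := by
  induction s with
  | zero =>
    intro U hSU _ hr h hh
    rw [zero_add] at hr
    rw [Submodule.eq_of_le_of_finrank_le hSU hr]
    simpa using hh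
  | succ s ih =>
    intro U hSU hU hr h hh
    have hle : S ⊔ U.map Z ≤ U :=
      sup_le hSU (Submodule.map_le_iff_le_comap.2 fun x hx => hU x hx)
    have hZh : Z h ∈ S ⊔ U.map Z := Submodule.mem_sup_right ⟨h, hh, rfl⟩
    have hstab : ∀ x ∈ S ⊔ U.map Z, Z x ∈ S ⊔ U.map Z := fun x hx =>
      Submodule.mem_sup_right ⟨x, hle hx, rfl⟩
    rw [pow_succ, Module.End.mul_apply]
    rcases hle.lt_or_eq with hlt | heq
    · refine ih _ le_sup_left hstab ?_ _ hZh
      have := Submodule.finrank_lt_finrank_of_lt hlt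
      omega
    · have hall : ∀ i, ∀ u ∈ U, ∃ w ∈ U, u - (Z ^ i) w ∈ S := by
        intro i
        induction i with
        | zero => intro u hu; exact ⟨u, hu, by simp⟩
        | succ i ih2 =>
          intro u hu
          obtain ⟨w, hw, hw'⟩ := ih2 u hu
          rw [← heq] at hw
          obtain ⟨y, hy, v, ⟨w', hw'U, rfl⟩, rfl⟩ := Submodule.mem_sup.1 hw
          refine ⟨w', hw'U, ?_⟩
          have hyS : ∀ j, (Z ^ j) y ∈ S := by
            intro j
            induction j with
            | zero => simpa using hy
            | succ j ihj => rw [pow_succ', Module.End.mul_apply]; exact hS _ ihj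
          have := S.add_mem hw' (hyS i)
          rw [pow_succ, Module.End.mul_apply]
          convert this using 1
          rw [map_add]
          abel
      have hUS : U ≤ S := by
        intro u hu
        obtain ⟨w, _, hw⟩ := hall m u hu
        simpa [hZ] using hw
      have : ∀ j, (Z ^ j) (Z h) ∈ U := by
        intro j
        induction j with
        | zero => simpa using hU _ hh
        | succ j ihj => rw [pow_succ', Module.End.mul_apply]; exact hU _ ihj
      exact hUS (this s)

lemma aux_dim [FiniteDimensional k W] (σ : k →+* k) [RingHomSurjective σ] (Φ : W →ₛₗ[σ] W)
    (X U : Submodule k W) :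
    ∃ Y : Submodule k W, (X ⊓ U.comap Φ) ⊔ Y = X ∧
      Module.finrank k Y + Module.finrank k U ≤ Module.finrank k (X.map Φ ⊔ U : Submodule k W) := by
  obtain ⟨C, hC⟩ := exists_isCompl (X ⊓ U.comap Φ)
  have hle : X ⊓ U.comap Φ ≤ X := inf_le_left
  refine ⟨C ⊓ X, ?_, ?_⟩
  · rw [← sup_inf_assoc_of_le C hle, hC.sup_eq_top, top_inf_eq]
  · have hker : ∀ y ∈ C ⊓ X, Φ y ∈ U → y = 0 := by
      intro y hy hyU
      have : y ∈ (X ⊓ U.comap Φ) ⊓ C := ⟨⟨hy.2, hyU⟩, hy.1⟩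
      rw [hC.inf_eq_bot] at this
      simpa using this
    have hdisj : (C ⊓ X).map Φ ⊓ U = ⊥ := by
      rw [eq_bot_iff]
      rintro _ ⟨⟨y, hy, rfl⟩, hyU⟩
      simp [hker y hy hyU]
    have h1 : Module.finrank k (C ⊓ X : Submodule k W) ≤ Module.finrank k ((C ⊓ X).map Φ) := by
      refine Module.finrank_le_finrank_of_rank_le_rank ?_ (Module.rank_lt_aleph0 _ _)
      rw [Cardinal.lift_le]
      refine rank_le_of_surjective_injective (R := k) (R' := k) (fun a => σ a)
        (AddMonoidHom.mk' (fun y : (C ⊓ X : Submodule k W) =>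
          (⟨Φ y, y, y.2, rfl⟩ : (C ⊓ X).map Φ)) ?_) (RingHomSurjective.is_surjective) ?_ ?_
      · intro x y
        ext
        simp
      · rw [injective_iff_map_eq_zero]
        intro y hy
        have : Φ (y : W) = 0 := congrArg Subtype.val hy
        ext
        exact hker y y.2 (by rw [this]; exact U.zero_mem)
      · intro a y
        ext
        simp
    have h2 := Submodule.finrank_sup_add_finrank_inf_eq ((C ⊓ X).map Φ) U
    rw [hdisj, finrank_bot] at h2
    have h3 : Module.finrank k ((C ⊓ X).map Φ ⊔ U : Submodule k W) ≤
        Module.finrank k (X.map Φ ⊔ U : Submodule k W) :=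
      Submodule.finrank_mono (sup_le_sup_right (Submodule.map_mono inf_le_right) U)
    omega

lemma aux_key [IsAlgClosed k] [FiniteDimensional k W] (q : ℕ) (hq0 : (q : k) = 0)
    (σ : k →+* k) [RingHomSurjective σ] (hσ : ∀ a, σ a = a ^ q)
    (Φ : W →ₛₗ[σ] W) (Ψ Z : W →ₗ[k] W)
    (hΦZ : ∀ x, Φ (Z x) = Z (Φ x)) (hΨZ : ∀ x, Ψ (Z x) = Z (Ψ x))
    (m : ℕ) (hZ : ∀ x, (Z ^ m) x = 0) (n : ℕ) :
    ∀ (X U : Submodule k W) (D : ℕ), Module.finrank k U ≤ n →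
      (∀ x ∈ X, Z x ∈ X) → (∀ x ∈ U, Z x ∈ U) → (∀ x ∈ X, Φ x ∈ U) → (∀ x ∈ X, Ψ x ∈ U) →
      Module.finrank k U ≤ D + Module.finrank k (X.map Ψ) →
      ∀ h ∈ U, ∃ x ∈ X, Φ x - Ψ x = (Z ^ D) h := by
  have hpow : ∀ (V : Submodule k W), (∀ x ∈ V, Z x ∈ V) → ∀ j, ∀ x ∈ V, (Z ^ j) x ∈ V := by
    intro V hV j x hx
    induction j with
    | zero => simpa using hx
    | succ j ihj => rw [pow_succ', Module.End.mul_apply]; exact hV _ ihj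
  have hΦp : ∀ j x, Φ ((Z ^ j) x) = (Z ^ j) (Φ x) := by
    intro j x
    induction j with
    | zero => simp
    | succ j ihj => rw [pow_succ', Module.End.mul_apply, Module.End.mul_apply, hΦZ, ihj]
  have hΨp : ∀ j x, Ψ ((Z ^ j) x) = (Z ^ j) (Ψ x) := by
    intro j x
    induction j with
    | zero => simp
    | succ j ihj => rw [pow_succ', Module.End.mul_apply, Module.End.mul_apply, hΨZ, ihj]
  induction n with
  | zero =>
    intro X U D hn hXZ hUZ hΦ hΨ hD h hh
    have : U = ⊥ := Submodule.finrank_eq_zero.1 (Nat.le_zero.1 hn)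
    subst this
    refine ⟨0, X.zero_mem, ?_⟩
    rw [(Submodule.mem_bot k).1 hh]
    simp
  | succ n ih =>
    intro X U D hn hXZ hUZ hΦ hΨ hD h hh
    have hle : X.map Ψ ≤ U := Submodule.map_le_iff_le_comap.2 fun x hx => hΨ x hx
    rcases hle.lt_or_eq with hlt | heq
    · set U' := X.map Ψ with hU'
      have hU'Z : ∀ x ∈ U', Z x ∈ U' := by
        rintro _ ⟨x, hx, rfl⟩
        exact ⟨Z x, hXZ x hx, hΨZ x⟩
      obtain ⟨Y, hY, hYd⟩ := aux_dim σ Φ X U'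
      set X' := X ⊓ U'.comap Φ with hX'
      have hX'Z : ∀ x ∈ X', Z x ∈ X' := by
        rintro x ⟨hx, hx'⟩
        refine ⟨hXZ x hx, ?_⟩
        show Φ (Z x) ∈ U'
        rw [hΦZ]
        exact hU'Z _ hx'
      have hlt' := Submodule.finrank_lt_finrank_of_lt hlt
      set S := X.map Φ ⊔ U' with hS
      have hSU : S ≤ U := sup_le (Submodule.map_le_iff_le_comap.2 fun x hx => hΦ x hx) hle
      have hSZ : ∀ x ∈ S, Z x ∈ S := by
        intro x hx
        obtain ⟨_, ⟨y, hy, rfl⟩, u, hu, rfl⟩ := Submodule.mem_sup.1 hx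
        rw [map_add, ← hΦZ]
        exact Submodule.add_mem_sup ⟨_, hXZ _ hy, rfl⟩ (hU'Z _ hu)
      have hSfin := Submodule.finrank_mono hSU
      have hdimΨ : Module.finrank k U' ≤ Module.finrank k (X'.map Ψ) + Module.finrank k Y := by
        have e : U' = X'.map Ψ ⊔ Y.map Ψ := by rw [← Submodule.map_sup, hY]
        have h1 := Submodule.finrank_add_le_finrank_add_finrank (X'.map Ψ) (Y.map Ψ)
        have h2 := Submodule.finrank_map_le Ψ Y
        rw [← e] at h1
        omega
      set s := Module.finrank k U - Module.finrank k S with hs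
      have hsD : s ≤ D := by
        have : Module.finrank k U' ≤ Module.finrank k S := Submodule.finrank_mono le_sup_right
        omega
      have hsh : (Z ^ s) h ∈ S := aux_nilp Z m hZ S hSZ s U hSU hUZ (by omega) h hh
      obtain ⟨_, ⟨y, hy, rfl⟩, u, hu, hyu⟩ := Submodule.mem_sup.1 hsh
      obtain ⟨x, hx, hxe⟩ := ih X' U' (D - s) (by omega) hX'Z hU'Z (fun x hx => hx.2)
        (fun x hx => ⟨x, hx.1, rfl⟩) (by omega) (u + Ψ y) (U'.add_mem hu ⟨y, hy, rfl⟩)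
      refine ⟨x + (Z ^ (D - s)) y, X.add_mem hx.1 (hpow X hXZ _ _ hy), ?_⟩
      have : (Z ^ D) h = (Z ^ (D - s)) ((Z ^ s) h) := by
        rw [← Module.End.mul_apply, ← pow_add, Nat.sub_add_cancel hsD]
      rw [this, ← hyu, map_add, map_add, hΦp, hΨp, add_sub_add_comm, hxe, map_add, map_add]
      abel
    · refine aux_lang_s2 q hq0 σ hσ Φ Ψ X U hΦ ?_ _ (hpow U hUZ _ _ hh)
      intro u hu
      rw [← heq] at hu
      obtain ⟨x, hx, hxe⟩ := hu
      exact ⟨x, hx, hxe⟩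

end Abstract

section Series

open PowerSeries in
/-- The map `x ↦ B' σ(x)` as a semilinear map over `k`. -/
def phiMap {k : Type*} [Field k] {r : ℕ} (σ : k →+* k) (B' : Matrix (Fin r) (Fin r) k⟦X⟧) :
    Matrix (Fin r) (Fin r) k⟦X⟧ →ₛₗ[σ] Matrix (Fin r) (Fin r) k⟦X⟧ where
  toFun x := B' * x.map (PowerSeries.map σ)
  map_add' x y := by
    rw [← mul_add]
    congr 1
    ext i j : 2
    simp
  map_smul' a x := by
    rw [← Matrix.mul_smul]
    congr 1
    ext i j n
    simp

open PowerSeries in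
/-- The map `x ↦ x B` as a linear map over `k`. -/
def psiMap {k : Type*} [Field k] {r : ℕ} (B : Matrix (Fin r) (Fin r) k⟦X⟧) :
    Matrix (Fin r) (Fin r) k⟦X⟧ →ₗ[k] Matrix (Fin r) (Fin r) k⟦X⟧ where
  toFun x := x * B
  map_add' x y := add_mul _ _ _
  map_smul' a x := Matrix.smul_mul _ _ _

open PowerSeries in
/-- Multiplication by `z`. -/
def zMap {k : Type*} [Field k] (r : ℕ) :
    Matrix (Fin r) (Fin r) k⟦X⟧ →ₗ[k] Matrix (Fin r) (Fin r) k⟦X⟧ where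
  toFun x := (X : k⟦X⟧) • x
  map_add' x y := smul_add _ _ _
  map_smul' a x := smul_comm _ _ _

open PowerSeries in
/-- Coefficients below `v`. -/
def coefMap {k : Type*} [Field k] (r v : ℕ) :
    Matrix (Fin r) (Fin r) k⟦X⟧ →ₗ[k] (Fin r × Fin r × Fin v → k) where
  toFun x := fun a => coeff a.2.2 (x a.1 a.2.1)
  map_add' x y := by ext; simp
  map_smul' a x := by ext; simp

open PowerSeries in
lemma zMap_pow {k : Type*} [Field k] {r : ℕ} (n : ℕ) (x : Matrix (Fin r) (Fin r) k⟦X⟧) :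
    ((zMap r) ^ n) x = ((X : k⟦X⟧) ^ n) • x := by
  induction n with
  | zero => simp
  | succ n ih =>
    rw [pow_succ', Module.End.mul_apply, ih, pow_succ', mul_smul]
    rfl

open PowerSeries in
lemma coefMap_ker {k : Type*} [Field k] {r v : ℕ} (x : Matrix (Fin r) (Fin r) k⟦X⟧)
    (hx : coefMap r v x = 0) : ∃ y, x = ((X : k⟦X⟧) ^ v) • y := by
  have : ∀ i j, ∃ y, x i j = (X : k⟦X⟧) ^ v * y := by
    intro i j
    refine X_pow_dvd_iff.2 fun m hm => ?_
    exact congrFun hx (i, j, ⟨m, hm⟩)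
  choose y hy using this
  exact ⟨y, Matrix.ext fun i j => hy i j⟩

open PowerSeries in
lemma quot_fin {k : Type*} [Field k] {r v : ℕ} (S : Submodule k (Matrix (Fin r) (Fin r) k⟦X⟧))
    (hS : ∀ y : Matrix (Fin r) (Fin r) k⟦X⟧, ((X : k⟦X⟧) ^ v) • y ∈ S) :
    Module.Finite k (Matrix (Fin r) (Fin r) k⟦X⟧ ⧸ S) ∧
      Module.finrank k (Matrix (Fin r) (Fin r) k⟦X⟧ ⧸ S) ≤ r * r * v := by
  have hle : (coefMap (k := k) r v).ker ≤ S := by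
    intro x hx
    obtain ⟨y, rfl⟩ := coefMap_ker x hx
    exact hS y
  have e := (coefMap (k := k) r v).quotKerEquivRange
  have : Module.Finite k (Matrix (Fin r) (Fin r) k⟦X⟧ ⧸ (coefMap (k := k) r v).ker) :=
    Module.Finite.equiv e.symm
  have hsurj : Function.Surjective (Submodule.factor hle) := Submodule.factor_surjective hle
  refine ⟨Module.Finite.of_surjective _ hsurj, ?_⟩
  refine (LinearMap.finrank_le_finrank_of_surjective hsurj).trans ?_
  rw [e.finrank_eq]
  refine (Submodule.finrank_le _).trans ?_
  simp [mul_assoc]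

open PowerSeries in
lemma ps_approx {k : Type*} [Field k] [IsAlgClosed k] (q : ℕ) (hq0 : (q : k) = 0)
    (σ : k →+* k) [RingHomSurjective σ] (hσ : ∀ a, σ a = a ^ q) {r : ℕ}
    (B B' C : Matrix (Fin r) (Fin r) k⟦X⟧) (v : ℕ) (hC : C * B = ((X : k⟦X⟧) ^ v) • 1)
    (m : ℕ) (h : Matrix (Fin r) (Fin r) k⟦X⟧) :
    ∃ x y : Matrix (Fin r) (Fin r) k⟦X⟧,
      ((X : k⟦X⟧) ^ (r * r * v)) • h =
        (B' * x.map (PowerSeries.map σ) - x * B) + ((X : k⟦X⟧) ^ m) • y := by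
  let S : Submodule k (Matrix (Fin r) (Fin r) k⟦X⟧) := LinearMap.range ((zMap (k := k) r) ^ m)
  have hSmem : ∀ x, x ∈ S ↔ ∃ y, ((X : k⟦X⟧) ^ m) • y = x := by
    intro x
    simp only [S, LinearMap.mem_range, zMap_pow]
  have hS := quot_fin S (fun y => (hSmem _).2 ⟨y, rfl⟩)
  have := hS.1
  have hΦX : ∀ (n : ℕ) x, phiMap σ B' (((X : k⟦X⟧) ^ n) • x) = ((X : k⟦X⟧) ^ n) • phiMap σ B' x := by
    intro n x
    show B' * _ = _ • (B' * _)
    rw [← Matrix.mul_smul]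
    congr 1
    ext i j : 2
    simp
  have hΨX : ∀ (n : ℕ) x, psiMap B (((X : k⟦X⟧) ^ n) • x) = ((X : k⟦X⟧) ^ n) • psiMap B x := by
    intro n x
    exact Matrix.smul_mul ((X : k⟦X⟧) ^ n) x B
  have hZ1 : ∀ x : Matrix (Fin r) (Fin r) k⟦X⟧, zMap r x = ((X : k⟦X⟧) ^ 1) • x := by
    intro x
    rw [pow_one]; rfl
  have hS1 : S ≤ S.comap (phiMap σ B') := by
    intro x hx
    obtain ⟨y, rfl⟩ := (hSmem x).1 hx
    show _ ∈ S
    rw [hΦX]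
    exact (hSmem _).2 ⟨_, rfl⟩
  have hS2 : S ≤ S.comap (psiMap B) := by
    intro x hx
    obtain ⟨y, rfl⟩ := (hSmem x).1 hx
    show _ ∈ S
    rw [hΨX]
    exact (hSmem _).2 ⟨_, rfl⟩
  have hS3 : S ≤ S.comap (zMap r) := by
    intro x hx
    obtain ⟨y, rfl⟩ := (hSmem x).1 hx
    show _ ∈ S
    rw [hZ1, smul_comm]
    exact (hSmem _).2 ⟨_, rfl⟩
  let Φ := S.mapQ S (phiMap σ B') hS1
  let Ψ := S.mapQ S (psiMap B) hS2
  let Z := S.mapQ S (zMap r) hS3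
  have hZp : ∀ n x, (Z ^ n) (S.mkQ x) = S.mkQ (((X : k⟦X⟧) ^ n) • x) := by
    intro n x
    induction n with
    | zero => simp
    | succ n ih =>
      rw [pow_succ', Module.End.mul_apply, ih, pow_succ', mul_smul]
      rfl
  have hfin : Module.finrank k (⊤ : Submodule k (Matrix (Fin r) (Fin r) k⟦X⟧ ⧸ S)) ≤
      r * r * v + Module.finrank k ((⊤ : Submodule k (Matrix (Fin r) (Fin r) k⟦X⟧ ⧸ S)).map Ψ) := by
    set R := (⊤ : Submodule k (Matrix (Fin r) (Fin r) k⟦X⟧ ⧸ S)).map Ψ with hR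
    have h1 := Submodule.finrank_quotient_add_finrank R
    have hT : ∀ y : Matrix (Fin r) (Fin r) k⟦X⟧, ((X : k⟦X⟧) ^ v) • y ∈ R.comap S.mkQ := by
      intro y
      refine ⟨S.mkQ (y * C), trivial, ?_⟩
      show S.mkQ (y * C * B) = _
      rw [mul_assoc, hC, Matrix.mul_smul, mul_one]
    have hT' := quot_fin (R.comap S.mkQ) hT
    have := hT'.1
    have hsurj : Function.Surjective ((R.comap S.mkQ).mapQ R S.mkQ le_rfl) := by
      intro x
      obtain ⟨x, rfl⟩ := R.mkQ_surjective x
      obtain ⟨x, rfl⟩ := S.mkQ_surjective x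
      exact ⟨(R.comap S.mkQ).mkQ x, rfl⟩
    have h2 := LinearMap.finrank_le_finrank_of_surjective hsurj
    rw [finrank_top]
    omega
  obtain ⟨x, -, hx⟩ := aux_key q hq0 σ hσ Φ Ψ Z
    (by
      intro x
      obtain ⟨x, rfl⟩ := S.mkQ_surjective x
      show S.mkQ (phiMap σ B' (zMap r x)) = S.mkQ (zMap r (phiMap σ B' x))
      rw [hZ1, hZ1, hΦX])
    (by
      intro x
      obtain ⟨x, rfl⟩ := S.mkQ_surjective x
      show S.mkQ (psiMap B (zMap r x)) = S.mkQ (zMap r (psiMap B x))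
      rw [hZ1, hZ1, hΨX])
    m
    (by
      intro x
      obtain ⟨x, rfl⟩ := S.mkQ_surjective x
      rw [hZp]
      exact (Submodule.Quotient.mk_eq_zero S).2 ((hSmem _).2 ⟨_, rfl⟩))
    _ ⊤ ⊤ (r * r * v) le_rfl (fun _ _ => trivial) (fun _ _ => trivial) (fun _ _ => trivial)
    (fun _ _ => trivial) hfin (S.mkQ h) trivial
  obtain ⟨x, rfl⟩ := S.mkQ_surjective x
  rw [hZp] at hx
  have hx' : S.mkQ (phiMap σ B' x - psiMap B x) = S.mkQ (((X : k⟦X⟧) ^ (r * r * v)) • h) := by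
    rw [← hx, map_sub]; rfl
  obtain ⟨y, hy⟩ := (hSmem _).1 ((Submodule.Quotient.eq S).1 hx'.symm)
  refine ⟨x, y, ?_⟩
  rw [hy]
  show _ = (phiMap σ B' x - psiMap B x) + _
  abel

open PowerSeries in
lemma ps_solve {k : Type*} [Field k] [IsAlgClosed k] (q : ℕ) (hq0 : (q : k) = 0)
    (σ : k →+* k) [RingHomSurjective σ] (hσ : ∀ a, σ a = a ^ q) {r : ℕ}
    (B B' C : Matrix (Fin r) (Fin r) k⟦X⟧) (v : ℕ) (hC : C * B = ((X : k⟦X⟧) ^ v) • 1)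
    (h : Matrix (Fin r) (Fin r) k⟦X⟧) :
    ∃ x : Matrix (Fin r) (Fin r) k⟦X⟧,
      B' * x.map (PowerSeries.map σ) - x * B = ((X : k⟦X⟧) ^ (r * r * v)) • h := by
  set c := r * r * v with hc
  choose s t hst using ps_approx q hq0 σ hσ B B' C v hC (c + 1)
  let ψ : Matrix (Fin r) (Fin r) k⟦X⟧ → Matrix (Fin r) (Fin r) k⟦X⟧ :=
    fun x => B' * x.map (PowerSeries.map σ) - x * B
  have hψ : ∀ x y, ψ (x + (X : k⟦X⟧) • y) = ψ x + (X : k⟦X⟧) • ψ y := by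
    intro x y
    have : (x + (X : k⟦X⟧) • y).map (PowerSeries.map σ)
        = x.map (PowerSeries.map σ) + (X : k⟦X⟧) • y.map (PowerSeries.map σ) := by
      ext i j : 2
      simp
    simp only [ψ, this, mul_add, add_mul, Matrix.mul_smul, Matrix.smul_mul, smul_sub]
    abel
  let T : (ℕ → Matrix (Fin r) (Fin r) k⟦X⟧) → Matrix (Fin r) (Fin r) k⟦X⟧ :=
    fun a => Matrix.of fun i j => PowerSeries.mk fun n =>
      ∑ l ∈ Finset.range (n + 1), coeff (n - l) (a l i j)
  have hT : ∀ a, T a = a 0 + (X : k⟦X⟧) • T (fun n => a (n + 1)) := by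
    intro a
    ext i j n
    cases n with
    | zero => simp [T]
    | succ n =>
      simp only [T, Matrix.of_apply, coeff_mk, Matrix.add_apply, Matrix.smul_apply, smul_eq_mul,
        map_add, coeff_succ_X_mul]
      rw [Finset.sum_range_succ']
      simp [add_comm]
  have hdvd : ∀ n g, ∃ y, ψ (T (fun i => s (t^[i] g))) - (X : k⟦X⟧) ^ c • g
      = (X : k⟦X⟧) ^ n • y := by
    intro n
    induction n with
    | zero => intro g; exact ⟨_, by rw [pow_zero, one_smul]⟩
    | succ n ih =>
      intro g
      obtain ⟨y, hy⟩ := ih (t g)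
      refine ⟨y, ?_⟩
      rw [hT, hψ]
      have e1 : (X : k⟦X⟧) ^ c • g = ψ (s g) + (X : k⟦X⟧) ^ (c + 1) • t g := hst g
      have e2 : (fun n => s (t^[n + 1] g)) = fun n => s (t^[n] (t g)) := rfl
      rw [e1, e2, pow_succ' _ n, mul_smul, ← hy,
        smul_sub (X : k⟦X⟧) (ψ (T fun i => s (t^[i] (t g)))), smul_smul, ← pow_succ']
      simp only [Function.iterate_zero, id_eq]
      abel
  refine ⟨T (fun i => s (t^[i] h)), ?_⟩
  show ψ _ = _
  rw [← sub_eq_zero]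
  ext i j n
  obtain ⟨y, hy⟩ := hdvd (n + 1) h
  rw [hy]
  simp [coeff_X_pow_mul']

end Series

section Transfer

variable {k : Type*} [Field k]

lemma exists_of_inZPow (n : ℕ) (x : LaurentSeries k) (hx : InZPow (n : ℤ) x) :
    ∃ y : PowerSeries k, HahnSeries.ofPowerSeries ℤ k (PowerSeries.X ^ n * y) = x := by
  refine ⟨PowerSeries.mk fun i => x.coeff ((n : ℤ) + i), ?_⟩
  ext m
  rw [PowerSeries.coeff_coe]
  split_ifs with hm
  · exact (hx m (by omega)).symm
  · rw [PowerSeries.coeff_X_pow_mul']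
    split_ifs with hn
    · rw [PowerSeries.coeff_mk]
      congr 1
      omega
    · exact (hx m (by omega)).symm

lemma inZPow_coe (n : ℕ) (y : PowerSeries k) :
    InZPow (n : ℤ) (HahnSeries.ofPowerSeries ℤ k (PowerSeries.X ^ n * y)) := by
  intro m hm
  rw [PowerSeries.coeff_coe]
  split_ifs with h0
  · rfl
  · rw [PowerSeries.coeff_X_pow_mul', if_neg (by omega)]

lemma exists_mat (n : ℕ) {r : ℕ} (x : Matrix (Fin r) (Fin r) (LaurentSeries k))
    (hx : ∀ i j, InZPow (n : ℤ) (x i j)) :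
    ∃ y : Matrix (Fin r) (Fin r) (PowerSeries k),
      (HahnSeries.ofPowerSeries ℤ k).mapMatrix (((PowerSeries.X : PowerSeries k) ^ n) • y) = x := by
  choose y hy using fun i j => exists_of_inZPow n (x i j) (hx i j)
  exact ⟨y, Matrix.ext fun i j => hy i j⟩

lemma exists_mat_zero {r : ℕ} (x : Matrix (Fin r) (Fin r) (LaurentSeries k))
    (hx : ∀ i j, InPS (x i j)) :
    ∃ y : Matrix (Fin r) (Fin r) (PowerSeries k),
      (HahnSeries.ofPowerSeries ℤ k).mapMatrix y = x := by
  obtain ⟨y, hy⟩ := exists_mat 0 x (fun i j m hm => hx i j m (by simpa using hm))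
  exact ⟨y, by simpa using hy⟩

lemma inPS_coe (y : PowerSeries k) : InPS (HahnSeries.ofPowerSeries ℤ k y) := by
  intro m hm
  rw [PowerSeries.coeff_coe, if_pos hm]

lemma matFrob_coe (q : ℕ) (hq : q ≠ 0) (σ : k →+* k) (hσ : ∀ a, σ a = a ^ q) {r : ℕ}
    (x : Matrix (Fin r) (Fin r) (PowerSeries k)) :
    matFrob q ((HahnSeries.ofPowerSeries ℤ k).mapMatrix x) =
      (HahnSeries.ofPowerSeries ℤ k).mapMatrix (x.map (PowerSeries.map σ)) := by
  ext i j m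
  simp only [matFrob, laurentFrob, dif_neg hq, Matrix.map_apply, RingHom.mapMatrix_apply,
    HahnSeries.map_coeff, PowerSeries.coeff_coe]
  split_ifs with h
  · simp [hq]
  · simp [hσ]

end Transfer



/-- **Corollary A.3**:  given Hodge bounds `μ, μ'`, there is a `c ∈ ℕ` (depending only on
`μ, μ'` with `r`, `q` and `k` fixed) such that for all effective local shtukas
`(k⟦z⟧^r, b·σ)` bounded by `μ` and `(k⟦z⟧^r, b'·σ)` bounded by `μ'`, all `d ∈ ℕ`, and every
`g ∈ M_r(k⟦z⟧)` with `b'·σ(g) − g·b ∈ z^(c+d)·M_r(k⟦z⟧)` there is a homomorphism of local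
shtukas `f : (k⟦z⟧^r, b·σ) → (k⟦z⟧^r, b'·σ)` with `f − g ∈ z^d·M_r(k⟦z⟧)`. -/
theorem hom_approximation
    {p : ℕ} (hp : p.Prime) {e : ℕ} (he : 1 ≤ e) {q : ℕ} (hq : q = p ^ e)
    {k : Type*} [Field k] [IsAlgClosed k] [CharP k p]
    {r : ℕ} (hr : 1 ≤ r)
    (μ μ' : Fin r → ℤ) (hμanti : Antitone μ) (hμ0 : ∀ i, 0 ≤ μ i)
    (hμ'anti : Antitone μ') (hμ'0 : ∀ i, 0 ≤ μ' i) :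
    ∃ c : ℕ, ∀ b b' g : Matrix (Fin r) (Fin r) (LaurentSeries k), ∀ d : ℕ,
      (∀ i j, InPS (b i j)) → IsUnit b → BoundedBy μ b →
      (∀ i j, InPS (b' i j)) → IsUnit b' → BoundedBy μ' b' →
      (∀ i j, InPS (g i j)) →
      (∀ i j, InZPow ((c : ℤ) + (d : ℤ)) ((b' * matFrob q g - g * b) i j)) →
      ∃ f : Matrix (Fin r) (Fin r) (LaurentSeries k),
        (∀ i j, InPS (f i j)) ∧ f * b = b' * matFrob q f ∧
        (∀ i j, InZPow (d : ℤ) ((f - g) i j)) := by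
  haveI : Fact p.Prime := ⟨hp⟩
  have hq0 : q ≠ 0 := by rw [hq]; exact pow_ne_zero _ hp.ne_zero
  have hqk : (q : k) = 0 := by
    rw [hq, Nat.cast_pow, CharP.cast_eq_zero, zero_pow (by omega)]
  let σ : k →+* k := iterateFrobenius k p e
  have hσ : ∀ a, σ a = a ^ q := by
    intro a
    rw [hq]
    exact iterateFrobenius_def p e a
  haveI : RingHomSurjective σ := ⟨fun a => by
    obtain ⟨y, hy⟩ := IsAlgClosed.exists_pow_nat_eq a (Nat.pos_of_ne_zero hq0)
    exact ⟨y, by rw [hσ, hy]⟩⟩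
  let v : ℕ := (∑ j, μ j).toNat
  have hv : ((v : ℕ) : ℤ) = ∑ j, μ j := Int.toNat_of_nonneg (Finset.sum_nonneg fun j _ => hμ0 j)
  let ι := HahnSeries.ofPowerSeries ℤ k
  have hι : Function.Injective ι := HahnSeries.ofPowerSeries_injective
  have hιM : Function.Injective (ι.mapMatrix (m := Fin r)) := by
    intro x y hxy
    exact Matrix.ext fun i j => hι (congrFun (congrFun hxy i) j)
  refine ⟨r * r * v, ?_⟩
  intro b b' g d hb _ hbμ hb' _ _ hg herr
  obtain ⟨B, hB⟩ := exists_mat_zero b hb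
  obtain ⟨B', hB'⟩ := exists_mat_zero b' hb'
  obtain ⟨G, hG⟩ := exists_mat_zero g hg
  obtain ⟨H, hH⟩ := exists_mat (r * r * v + d) _ (fun i j => by
    have := herr i j
    rwa [← Nat.cast_add] at this)
  obtain ⟨_, u, ⟨hu, w, hw, huw⟩, hdet⟩ := hbμ
  obtain ⟨u', hu'⟩ := exists_of_inZPow 0 u (fun m hm => hu m (by simpa using hm))
  obtain ⟨w', hw'⟩ := exists_of_inZPow 0 w (fun m hm => hw m (by simpa using hm))
  rw [pow_zero, one_mul] at hu' hw'
  have huw' : u' * w' = 1 := by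
    apply hι
    rw [map_mul, map_one]
    show ι u' * ι w' = 1
    rw [show ι u' = u from hu', show ι w' = w from hw', huw]
  have hdet' : B.det = PowerSeries.X ^ v * u' := by
    apply hι
    rw [RingHom.map_det, show ι.mapMatrix B = b from hB, hdet, map_mul, show ι u' = u from hu',
      HahnSeries.ofPowerSeries_X_pow, zPow, ← hv]
  have hC : (w' • B.adjugate) * B = ((PowerSeries.X : PowerSeries k) ^ v) • 1 := by
    rw [Matrix.smul_mul, Matrix.adjugate_mul, hdet', smul_smul, mul_comm w', mul_assoc, huw',
      mul_one]
  obtain ⟨x, hx⟩ := ps_solve q hqk σ hσ B B' (w' • B.adjugate) v hC (-H)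
  have herr' : B' * G.map (PowerSeries.map σ) - G * B
      = ((PowerSeries.X : PowerSeries k) ^ (r * r * v + d)) • H := by
    apply hιM
    rw [show ι.mapMatrix _ = _ from hH, map_sub, map_mul, map_mul, show ι.mapMatrix B = b from hB,
      show ι.mapMatrix B' = b' from hB', show ι.mapMatrix G = g from hG,
      ← show _ = ι.mapMatrix _ from matFrob_coe q hq0 σ hσ G, hG]
  let F := G + ((PowerSeries.X : PowerSeries k) ^ d) • x
  have hF : F.map (PowerSeries.map σ) = G.map (PowerSeries.map σ)
      + ((PowerSeries.X : PowerSeries k) ^ d) • x.map (PowerSeries.map σ) := by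
    ext i j : 2
    simp [F]
  have hFe : F * B = B' * F.map (PowerSeries.map σ) := by
    have e1 : B' * F.map (PowerSeries.map σ) - F * B =
        (B' * G.map (PowerSeries.map σ) - G * B)
        + ((PowerSeries.X : PowerSeries k) ^ d) •
          (B' * x.map (PowerSeries.map σ) - x * B) := by
      rw [hF, smul_sub, mul_add, Matrix.mul_smul]
      simp only [F]
      rw [add_mul, Matrix.smul_mul]
      abel
    rw [herr', hx, smul_smul, ← pow_add, add_comm d, smul_neg, add_neg_cancel] at e1
    exact (sub_eq_zero.1 e1).symm
  refine ⟨ι.mapMatrix F, fun i j => inPS_coe _, ?_, ?_⟩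
  · rw [show matFrob q (ι.mapMatrix F) = _ from matFrob_coe q hq0 σ hσ F, ← hB, ← hB']
    show ι.mapMatrix F * ι.mapMatrix B = ι.mapMatrix B' * ι.mapMatrix _
    rw [← map_mul, ← map_mul, hFe]
  · intro i j
    have : (ι.mapMatrix F - g) i j = ι (PowerSeries.X ^ d * x i j) := by
      rw [← hG]
      show ι (F i j) - ι (G i j) = _
      rw [← map_sub]
      simp [F]
    rw [this]
    exact inZPow_coe d _

end HVpaper
end
end
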